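/- arXiv:1702.05760 — 2 statements merged into one kernel-verified Lean document; each statement's English description precedes it below -/
import Mathlib

section
/- Let θ ∈ (0, arccos(2/π)) (equivalently cos θ > 2/π), and let β₀ ∈ (1, ∞) be a real number satisfying β₀ cos θ > 1 and arccos(−1/β₀) = (β₀ − cos θ)·√(β₀² − 1) / (β₀·(β₀ cos θ − 1)). Then the hypercube-LSH collision probability satisfies lim_{d→∞} (1/d)·ln p_d(θ) = ln( (β₀ − cos θ)² / (π · β₀ · (β₀ cos θ − 1) · sin θ) ). -/
open MeasureTheory Real Filter

noncomputable section

instance (d : ℕ) : MeasurableSpace (Matrix (Fin d) (Fin d) ℝ) := MeasurableSpace.pi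

/-- The sign function: `+1` if `t ≥ 0` and `-1` if `t < 0`. -/
def sgn (t : ℝ) : ℝ := if 0 ≤ t then 1 else -1

/-- The unit vector `x = e₁` in `ℝ^d`. -/
def xvec (d : ℕ) : Fin d → ℝ := fun i => if (i : ℕ) = 0 then 1 else 0

/-- The unit vector `y = (cos θ) e₁ + (sin θ) e₂` in `ℝ^d`. -/
def yvec (d : ℕ) (θ : ℝ) : Fin d → ℝ :=
  fun i => if (i : ℕ) = 0 then Real.cos θ else if (i : ℕ) = 1 then Real.sin θ else 0

/-- The event that the hypercube hashes of `x` and `y` coincide: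
`h_A(x) = h_A(y)` where `h_A(v) = (sgn((Av)₁), …, sgn((Av)_d))`. -/
def collisionEvent (d : ℕ) (θ : ℝ) : Set (Matrix.orthogonalGroup (Fin d) ℝ) :=
  {A | ∀ i : Fin d,
    sgn (((A : Matrix (Fin d) (Fin d) ℝ).mulVec (xvec d)) i)
      = sgn (((A : Matrix (Fin d) (Fin d) ℝ).mulVec (yvec d θ)) i)}

/-- The hypercube-LSH collision probability `p_d(θ)`, where `μ` is the Haar probability
measure on the orthogonal group `O(d)`. -/
def collProb (d : ℕ) (θ : ℝ) (μ : Measure (Matrix.orthogonalGroup (Fin d) ℝ)) : ℝ :=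
  (μ (collisionEvent d θ)).toReal


def act {d : ℕ} (A : Matrix (Fin d) (Fin d) ℝ) (W : Fin d → ℝ × ℝ) : Fin d → ℝ × ℝ :=
  fun i => (A.mulVec (fun j => (W j).1) i, A.mulVec (fun j => (W j).2) i)

lemma sgn_measurable : Measurable sgn := by
  unfold sgn
  exact Measurable.ite measurableSet_Ici measurable_const measurable_const

lemma entry_measurable {d : ℕ} (i j : Fin d) :
    Measurable (fun A : Matrix.orthogonalGroup (Fin d) ℝ => (A : Matrix (Fin d) (Fin d) ℝ) i j) :=
  (measurable_pi_apply j).comp ((measurable_pi_apply i).comp measurable_subtype_coe)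

lemma measurable_to_orth {d : ℕ} {α : Type*} [MeasurableSpace α]
    (f : α → Matrix.orthogonalGroup (Fin d) ℝ)
    (h : ∀ i j, Measurable (fun a => (f a : Matrix (Fin d) (Fin d) ℝ) i j)) : Measurable f := by
  refine Measurable.subtype_mk (f := fun a => (f a : Matrix (Fin d) (Fin d) ℝ)) (h := fun a => (f a).2) ?_
  exact measurable_pi_iff.2 fun i => measurable_pi_iff.2 fun j => h i j

instance orth_mul (d : ℕ) : MeasurableMul₂ (Matrix.orthogonalGroup (Fin d) ℝ) := by
  constructor
  apply measurable_to_orth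
  intro i j
  simp only [Submonoid.coe_mul, Matrix.mul_apply]
  refine Finset.measurable_sum _ fun k _ => ?_
  exact ((entry_measurable i k).comp measurable_fst).mul ((entry_measurable k j).comp measurable_snd)

instance orth_inv (d : ℕ) : MeasurableInv (Matrix.orthogonalGroup (Fin d) ℝ) := by
  constructor
  apply measurable_to_orth
  intro i j
  exact entry_measurable j i

lemma right_inv {G : Type*} [Group G] [MeasurableSpace G] [MeasurableMul₂ G] [MeasurableInv G]
    (μ : Measure G) [IsProbabilityMeasure μ] [μ.IsMulLeftInvariant] : μ.IsMulRightInvariant := by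
  have : IsProbabilityMeasure μ.inv := ⟨by simp⟩
  have key : μ.inv = μ := by
    ext s hs
    have hm : Measurable (fun p : G × G => s.indicator (1 : G → ENNReal) (p.1 * p.2)) :=
      (measurable_one.indicator hs).comp measurable_mul
    have h1 : ∫⁻ x, ∫⁻ y, s.indicator (1 : G → ENNReal) (x * y) ∂μ ∂μ.inv = μ s := by
      simp_rw [lintegral_mul_left_eq_self (μ := μ) (s.indicator (1 : G → ENNReal))]
      simp [lintegral_indicator_one hs]
    have h2 : ∫⁻ x, ∫⁻ y, s.indicator (1 : G → ENNReal) (x * y) ∂μ ∂μ.inv = μ.inv s := by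
      rw [lintegral_lintegral_swap hm.aemeasurable]
      simp_rw [lintegral_mul_right_eq_self (μ := μ.inv) (s.indicator (1 : G → ENNReal))]
      simp [lintegral_indicator_one hs]
    rw [← h1, ← h2]
  rw [← key]; infer_instance

lemma act_mp {d : ℕ} (A : Matrix.orthogonalGroup (Fin d) ℝ) :
    MeasurePreserving (act (A : Matrix (Fin d) (Fin d) ℝ)) volume volume := by
  have hdet : |(A : Matrix (Fin d) (Fin d) ℝ).det| = 1 := by
    have := Matrix.UnitaryGroup.det_isUnit A
    have h2 : (A : Matrix (Fin d) (Fin d) ℝ).det * (A : Matrix (Fin d) (Fin d) ℝ).det = 1 := by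
      have h3 := (Matrix.mem_orthogonalGroup_iff _ _).1 A.2
      have := congrArg Matrix.det h3
      simpa using this
    have := abs_mul_abs_self (A : Matrix (Fin d) (Fin d) ℝ).det
    nlinarith [abs_nonneg (A : Matrix (Fin d) (Fin d) ℝ).det]
  have hne : (A : Matrix (Fin d) (Fin d) ℝ).det ≠ 0 := by
    intro h; rw [h] at hdet; simp at hdet
  have h1 : MeasurePreserving (fun v : Fin d → ℝ => (A : Matrix (Fin d) (Fin d) ℝ).mulVec v) volume volume := by
    refine ⟨?_, ?_⟩
    · exact (Matrix.toLin' (A : Matrix (Fin d) (Fin d) ℝ)).continuous_of_finiteDimensional.measurable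
    · have := Real.map_matrix_volume_pi_eq_smul_volume_pi hne
      rw [abs_inv, hdet] at this
      simp only [inv_one, ENNReal.ofReal_one, one_smul] at this
      exact this
  have h2 := volume_measurePreserving_arrowProdEquivProdArrow ℝ ℝ (Fin d)
  have h3 := (h2.symm.comp (h1.prod h1)).comp h2
  exact h3

lemma act_measurable2 (d : ℕ) :
    Measurable (fun p : Matrix.orthogonalGroup (Fin d) ℝ × (Fin d → ℝ × ℝ) =>
      act (p.1 : Matrix (Fin d) (Fin d) ℝ) p.2) := by
  refine measurable_pi_iff.2 fun i => ?_
  unfold act Matrix.mulVec dotProduct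
  refine Measurable.prodMk ?_ ?_
  · refine Finset.measurable_sum _ fun k _ => ?_
    exact ((entry_measurable i k).comp measurable_fst).mul
      (measurable_fst.comp ((measurable_pi_apply k).comp measurable_snd))
  · refine Finset.measurable_sum _ fun k _ => ?_
    exact ((entry_measurable i k).comp measurable_fst).mul
      (measurable_snd.comp ((measurable_pi_apply k).comp measurable_snd))

lemma averaging {d : ℕ} (μ : Measure (Matrix.orthogonalGroup (Fin d) ℝ)) [IsProbabilityMeasure μ]
    (E S : Set (Fin d → ℝ × ℝ)) (hE : MeasurableSet E) (hS : MeasurableSet S)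
    (hinv : ∀ A : Matrix.orthogonalGroup (Fin d) ℝ, ∀ W, act (A : Matrix (Fin d) (Fin d) ℝ) W ∈ S ↔ W ∈ S) :
    volume (E ∩ S) = ∫⁻ W in S, μ {A | act (A : Matrix (Fin d) (Fin d) ℝ) W ∈ E} := by
  have hm : Measurable (fun p : Matrix.orthogonalGroup (Fin d) ℝ × (Fin d → ℝ × ℝ) =>
      E.indicator (1 : (Fin d → ℝ × ℝ) → ENNReal) (act (p.1 : Matrix (Fin d) (Fin d) ℝ) p.2)) :=
    (measurable_one.indicator hE).comp (act_measurable2 d)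
  have h1 : ∀ A : Matrix.orthogonalGroup (Fin d) ℝ,
      ∫⁻ W in S, E.indicator (1 : (Fin d → ℝ × ℝ) → ENNReal) (act (A : Matrix (Fin d) (Fin d) ℝ) W) = volume (E ∩ S) := by
    intro A
    have hp : MeasurableSet (act (A : Matrix (Fin d) (Fin d) ℝ) ⁻¹' E) := (act_mp A).measurable hE
    have : (fun W => E.indicator (1 : (Fin d → ℝ × ℝ) → ENNReal) (act (A : Matrix (Fin d) (Fin d) ℝ) W)) =
      (act (A : Matrix (Fin d) (Fin d) ℝ) ⁻¹' E).indicator 1 := by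
      ext W; rfl
    rw [this, lintegral_indicator_one hp, Measure.restrict_apply hp]
    rw [← (act_mp A).measure_preimage (hE.inter hS).nullMeasurableSet]
    congr 1; ext W; simp [hinv A W]
  have h2 : ∫⁻ A, (∫⁻ W in S, E.indicator (1 : (Fin d → ℝ × ℝ) → ENNReal) (act (A : Matrix (Fin d) (Fin d) ℝ) W)) ∂μ
      = volume (E ∩ S) := by
    simp_rw [h1]; simp
  rw [← h2, lintegral_lintegral_swap hm.aemeasurable]
  refine lintegral_congr fun W => ?_
  have hW : Measurable (fun A : Matrix.orthogonalGroup (Fin d) ℝ => act (A : Matrix (Fin d) (Fin d) ℝ) W) :=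
    (act_measurable2 d).comp (measurable_id.prodMk measurable_const)
  have : (fun A : Matrix.orthogonalGroup (Fin d) ℝ => E.indicator (1 : (Fin d → ℝ × ℝ) → ENNReal) (act (A : Matrix (Fin d) (Fin d) ℝ) W)) =
      ((fun A : Matrix.orthogonalGroup (Fin d) ℝ => act (A : Matrix (Fin d) (Fin d) ℝ) W) ⁻¹' E).indicator 1 := by
      ext A; rfl
  rw [this, lintegral_indicator_one (hW hE)]
  rfl

lemma coll_mono {d : ℕ} {φ θ : ℝ} (h0 : 0 ≤ φ) (h1 : φ ≤ θ) (hθ : θ < π) :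
    collisionEvent d θ ⊆ collisionEvent d φ := by
  rcases h0.eq_or_lt with h0 | h0
  · subst h0
    intro A _ i
    have : yvec d 0 = xvec d := by ext i; simp [yvec, xvec]
    rw [this]
  have hs : 0 < sin θ := sin_pos_of_pos_of_lt_pi (h0.trans_le h1) hθ
  have hs' : 0 < sin φ := sin_pos_of_pos_of_lt_pi h0 (h1.trans_lt hθ)
  have ha : 0 ≤ sin (θ - φ) := sin_nonneg_of_nonneg_of_le_pi (by linarith) (by linarith)
  have hy : sin θ • yvec d φ = sin (θ - φ) • xvec d + sin φ • yvec d θ := by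
    ext i
    simp only [yvec, xvec, Pi.smul_apply, Pi.add_apply, smul_eq_mul]
    split_ifs <;> simp [sin_sub] <;> ring
  intro A hA i
  have hAi := hA i
  have h3 : sin θ * ((A : Matrix (Fin d) (Fin d) ℝ).mulVec (yvec d φ)) i =
     sin (θ - φ) * ((A : Matrix (Fin d) (Fin d) ℝ).mulVec (xvec d)) i + 
     sin φ * ((A : Matrix (Fin d) (Fin d) ℝ).mulVec (yvec d θ)) i := by
    have := congrArg (fun v => (A : Matrix (Fin d) (Fin d) ℝ).mulVec v i) hy
    simpa [Matrix.mulVec_add, Matrix.mulVec_smul] using this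
  generalize ((A : Matrix (Fin d) (Fin d) ℝ).mulVec (xvec d)) i = u at *
  generalize ((A : Matrix (Fin d) (Fin d) ℝ).mulVec (yvec d θ)) i = v at *
  generalize ((A : Matrix (Fin d) (Fin d) ℝ).mulVec (yvec d φ)) i = w at *
  unfold sgn at hAi ⊢
  by_cases hu : 0 ≤ u
  · have hv : 0 ≤ v := by
      by_contra hv; simp [hu, hv] at hAi; norm_num at hAi
    have hw : 0 ≤ w := by
      have : 0 ≤ sin θ * w := by rw [h3]; positivity
      exact nonneg_of_mul_nonneg_right this hs
    simp [hu, hw]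
  · have hv : ¬ 0 ≤ v := by
      intro hv; simp [hu, hv] at hAi; norm_num at hAi
    have hw : ¬ 0 ≤ w := by
      intro hw
      push Not at hu hv
      have : 0 ≤ sin θ * w := by positivity
      nlinarith
    simp [hu, hw]

lemma sgn_mul {a t : ℝ} (ha : 0 < a) : sgn (a * t) = sgn t := by
  unfold sgn
  simp [mul_nonneg_iff_of_pos_left ha]

lemma exists_frame {d : ℕ} (hd : 2 ≤ d) (X Y : Fin d → ℝ) {a b φ : ℝ} (ha : 0 < a) (hb : 0 < b)
    (hX : X ⬝ᵥ X = a ^ 2) (hY : Y ⬝ᵥ Y = b ^ 2) (hXY : X ⬝ᵥ Y = a * b * cos φ) (hs : 0 < sin φ) :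
    ∃ B : Matrix.orthogonalGroup (Fin d) ℝ,
      (B : Matrix (Fin d) (Fin d) ℝ).mulVec (a • xvec d) = X ∧
      (B : Matrix (Fin d) (Fin d) ℝ).mulVec (b • yvec d φ) = Y := by
  let i0 : Fin d := ⟨0, by omega⟩
  let i1 : Fin d := ⟨1, by omega⟩
  have h01 : i0 ≠ i1 := by simp [i0, i1]
  let u : Fin d → ℝ := a⁻¹ • X
  let v : Fin d → ℝ := (sin φ)⁻¹ • (b⁻¹ • Y - cos φ • u)
  have huu : u ⬝ᵥ u = 1 := by
    simp only [u, smul_dotProduct, dotProduct_smul, hX, smul_eq_mul]; field_simp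
  have huY : u ⬝ᵥ Y = b * cos φ := by
    simp only [u, smul_dotProduct, hXY, smul_eq_mul]; field_simp
  have huv : u ⬝ᵥ v = 0 := by
    simp only [v, dotProduct_smul, dotProduct_sub, huu, huY, smul_eq_mul]; field_simp; ring
  have hvv : v ⬝ᵥ v = 1 := by
    simp only [v, dotProduct_smul, dotProduct_sub, smul_dotProduct, sub_dotProduct, huu, huY, hY, dotProduct_comm Y u, smul_eq_mul]
    field_simp
    linarith [sin_sq_add_cos_sq φ]
  let f : Fin d → EuclideanSpace ℝ (Fin d) := fun i => if i = i0 then WithLp.toLp 2 u else WithLp.toLp 2 v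
  have hor : Orthonormal ℝ (({i0, i1} : Set (Fin d)).domRestrict f) := by
    rw [orthonormal_iff_ite]
    rintro ⟨i, hi⟩ ⟨j, hj⟩
    simp only [Set.mem_insert_iff, Set.mem_singleton_iff] at hi hj
    change inner ℝ (f i) (f j) = _
    rcases hi with rfl | rfl <;> rcases hj with rfl | rfl <;>
      simp only [f, h01, h01.symm, EuclideanSpace.inner_toLp_toLp, huu, huv, hvv, dotProduct_comm v u,
        star_trivial, if_true, if_false, Subtype.mk.injEq]
  obtain ⟨bs, hbs⟩ := hor.exists_orthonormalBasis_extension_of_card_eq (by simp)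
  have hb0 : bs i0 = WithLp.toLp 2 u := by rw [hbs i0 (by simp)]; simp [f]
  have hb1 : bs i1 = WithLp.toLp 2 v := by rw [hbs i1 (by simp)]; simp [f, h01.symm]
  let B : Matrix (Fin d) (Fin d) ℝ := Matrix.of fun i j => bs j i
  have hB : B ∈ Matrix.orthogonalGroup (Fin d) ℝ := by
    rw [Matrix.mem_orthogonalGroup_iff']
    ext i j
    have := orthonormal_iff_ite.1 bs.orthonormal i j
    rw [Matrix.mul_apply, Matrix.one_apply, ← this, PiLp.inner_apply]
    simp [B, mul_comm]
  have hBx : B.mulVec (xvec d) = u := by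
    have : xvec d = Pi.single i0 1 := by
      ext i; simp [xvec, Pi.single_apply, i0, Fin.ext_iff]
    rw [this, Matrix.mulVec_single_one]
    ext i; simp [B, hb0]
  have hBy : B.mulVec (yvec d φ) = cos φ • u + sin φ • v := by
    have : yvec d φ = cos φ • xvec d + sin φ • Pi.single i1 1 := by
      ext i; simp only [yvec, xvec, Pi.single_apply, i1, Fin.ext_iff, Pi.add_apply, Pi.smul_apply, smul_eq_mul]
      split_ifs <;> simp_all
    rw [this, Matrix.mulVec_add, Matrix.mulVec_smul, Matrix.mulVec_smul, hBx, Matrix.mulVec_single_one]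
    congr 2
    ext i; simp [B, hb1]
  refine ⟨⟨B, hB⟩, ?_, ?_⟩
  · rw [Matrix.mulVec_smul, hBx]; simp [u, smul_smul, ha.ne']
  · rw [Matrix.mulVec_smul, hBy]
    simp only [v, smul_smul, mul_inv_cancel₀ hs.ne', one_smul]
    simp [smul_smul, hb.ne']

lemma coll_eq {d : ℕ} (hd : 2 ≤ d) (μ : Measure (Matrix.orthogonalGroup (Fin d) ℝ))
    [IsProbabilityMeasure μ] [μ.IsMulLeftInvariant] (X Y : Fin d → ℝ) {a b φ : ℝ} (ha : 0 < a) (hb : 0 < b)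
    (hX : X ⬝ᵥ X = a ^ 2) (hY : Y ⬝ᵥ Y = b ^ 2) (hXY : X ⬝ᵥ Y = a * b * cos φ) (hs : 0 < sin φ) :
    μ {A | ∀ i, sgn ((A : Matrix (Fin d) (Fin d) ℝ).mulVec X i) = sgn ((A : Matrix (Fin d) (Fin d) ℝ).mulVec Y i)}
      = μ (collisionEvent d φ) := by
  obtain ⟨B, h1, h2⟩ := exists_frame hd X Y ha hb hX hY hXY hs
  have := right_inv μ
  rw [← measure_preimage_mul_right μ B (collisionEvent d φ)]
  congr 1
  ext A
  simp only [Set.mem_ofPred_eq, Set.mem_preimage, collisionEvent]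
  refine forall_congr' fun i => ?_
  rw [← h1, ← h2, Matrix.mulVec_smul, Matrix.mulVec_smul, Matrix.mulVec_smul, Matrix.mulVec_smul,
    Pi.smul_apply, Pi.smul_apply, smul_eq_mul, smul_eq_mul, sgn_mul ha, sgn_mul hb]
  simp [Matrix.mulVec_mulVec]

def SS (d : ℕ) (τ₁ τ₂ ε : ℝ) : Set (Fin d → ℝ × ℝ) :=
  {W | |∑ i, (W i).1 ^ 2 - d * τ₁| ≤ d * ε ∧ |∑ i, (W i).2 ^ 2 - d * τ₂| ≤ d * ε ∧
    |∑ i, (W i).1 * (W i).2| ≤ d * ε}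

def Wd (s k : ℝ) : Set (ℝ × ℝ) := {w | sgn (s * w.1 - k * w.2) = sgn (s * w.1 + k * w.2)}

def EE (d : ℕ) (s k : ℝ) : Set (Fin d → ℝ × ℝ) := Set.univ.pi fun _ => Wd s k

lemma Wd_meas (s k : ℝ) : MeasurableSet (Wd s k) := by
  apply measurableSet_eq_fun
  · exact sgn_measurable.comp (by fun_prop)
  · exact sgn_measurable.comp (by fun_prop)

lemma EE_meas (d : ℕ) (s k : ℝ) : MeasurableSet (EE d s k) :=
  MeasurableSet.univ_pi fun _ => Wd_meas s k

lemma SS_meas (d : ℕ) (τ₁ τ₂ ε : ℝ) : MeasurableSet (SS d τ₁ τ₂ ε) := by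
  have h1 : Measurable (fun W : Fin d → ℝ × ℝ => |∑ i, (W i).1 ^ 2 - d * τ₁|) := by fun_prop
  have h2 : Measurable (fun W : Fin d → ℝ × ℝ => |∑ i, (W i).2 ^ 2 - d * τ₂|) := by fun_prop
  have h3 : Measurable (fun W : Fin d → ℝ × ℝ => |∑ i, (W i).1 * (W i).2|) := by fun_prop
  exact (measurableSet_le h1 measurable_const).inter
    ((measurableSet_le h2 measurable_const).inter (measurableSet_le h3 measurable_const))

lemma orth_dot {d : ℕ} (A : Matrix.orthogonalGroup (Fin d) ℝ) (u v : Fin d → ℝ) :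
    (A : Matrix (Fin d) (Fin d) ℝ).mulVec u ⬝ᵥ (A : Matrix (Fin d) (Fin d) ℝ).mulVec v = u ⬝ᵥ v := by
  have h := (Matrix.mem_orthogonalGroup_iff' _ _).1 A.2
  rw [Matrix.dotProduct_mulVec, ← Matrix.mulVec_transpose, Matrix.mulVec_mulVec, h, Matrix.one_mulVec]

lemma SS_inv {d : ℕ} (τ₁ τ₂ ε : ℝ) (A : Matrix.orthogonalGroup (Fin d) ℝ) (W : Fin d → ℝ × ℝ) :
    act (A : Matrix (Fin d) (Fin d) ℝ) W ∈ SS d τ₁ τ₂ ε ↔ W ∈ SS d τ₁ τ₂ ε := by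
  have h1 := orth_dot A (fun i => (W i).1) (fun i => (W i).1)
  have h2 := orth_dot A (fun i => (W i).2) (fun i => (W i).2)
  have h3 := orth_dot A (fun i => (W i).1) (fun i => (W i).2)
  unfold dotProduct at h1 h2 h3
  simp only [SS, Set.mem_ofPred_eq, act, pow_two, h1, h2, h3]

def FF (s k : ℝ) (p : ℝ × ℝ × ℝ) : ℝ :=
  (s ^ 2 * p.1 - k ^ 2 * p.2.1) / (√(s ^ 2 * p.1 + k ^ 2 * p.2.1 - 2 * s * k * p.2.2)
    * √(s ^ 2 * p.1 + k ^ 2 * p.2.1 + 2 * s * k * p.2.2))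

lemma geo {s k τ₁ τ₂ c : ℝ} (hm : 0 < s ^ 2 * τ₁ + k ^ 2 * τ₂)
    (hc : s ^ 2 * τ₁ - k ^ 2 * τ₂ = c * (s ^ 2 * τ₁ + k ^ 2 * τ₂)) {l u : ℝ} (hl : l < c) (hu : c < u) :
    ∃ ε₀ > 0, ∀ p : ℝ × ℝ × ℝ, |p.1 - τ₁| ≤ ε₀ → |p.2.1 - τ₂| ≤ ε₀ → |p.2.2| ≤ ε₀ →
      l < FF s k p ∧ FF s k p < u ∧ 0 < s ^ 2 * p.1 + k ^ 2 * p.2.1 - 2 * s * k * p.2.2 ∧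
        0 < s ^ 2 * p.1 + k ^ 2 * p.2.1 + 2 * s * k * p.2.2 := by
  let p₀ : ℝ × ℝ × ℝ := (τ₁, τ₂, 0)
  have hF : FF s k p₀ = c := by
    simp only [FF, p₀, hc, mul_zero, sub_zero, add_zero]
    rw [Real.mul_self_sqrt hm.le]; field_simp
  have hcont : ContinuousAt (FF s k) p₀ := by
    unfold FF
    refine ContinuousAt.div (by fun_prop) (by fun_prop) ?_
    simp only [p₀, mul_zero, sub_zero, add_zero]
    rw [Real.mul_self_sqrt hm.le]; exact hm.ne'
  have c1 : ContinuousAt (fun p : ℝ × ℝ × ℝ => s ^ 2 * p.1 + k ^ 2 * p.2.1 - 2 * s * k * p.2.2) p₀ := by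
    fun_prop
  have c2 : ContinuousAt (fun p : ℝ × ℝ × ℝ => s ^ 2 * p.1 + k ^ 2 * p.2.1 + 2 * s * k * p.2.2) p₀ := by
    fun_prop
  have e1 := hcont.eventually (lt_mem_nhds (hF ▸ hl))
  have e2 := hcont.eventually (gt_mem_nhds (hF ▸ hu))
  have e3 := c1.eventually (lt_mem_nhds (a := 0) (by simpa [p₀] using hm))
  have e4 := c2.eventually (lt_mem_nhds (a := 0) (by simpa [p₀] using hm))
  obtain ⟨ε, hε, h⟩ := Metric.eventually_nhds_iff.1 (e1.and (e2.and (e3.and e4)))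
  refine ⟨ε / 2, by positivity, fun p h1 h2 h3 => h ?_⟩
  simp only [p₀, Prod.dist_eq, Real.dist_eq, sub_zero]
  refine max_lt (by linarith) (max_lt (by linarith) (by linarith))

lemma angle_exists {s k τ₁ τ₂ c : ℝ} (hm : 0 < s ^ 2 * τ₁ + k ^ 2 * τ₂)
    (hc : s ^ 2 * τ₁ - k ^ 2 * τ₂ = c * (s ^ 2 * τ₁ + k ^ 2 * τ₂)) {l u : ℝ} (hl : l < c) (hu : c < u)
    (hl1 : -1 ≤ l) (hu1 : u ≤ 1) :
    ∃ ε₀ > 0, ∀ ε ≤ ε₀, ∀ d : ℕ, 2 ≤ d → ∀ μ : Measure (Matrix.orthogonalGroup (Fin d) ℝ),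
      IsProbabilityMeasure μ → μ.IsMulLeftInvariant → ∀ W ∈ SS d τ₁ τ₂ ε,
      ∃ φ, 0 < φ ∧ φ < π ∧ l < cos φ ∧ cos φ < u ∧
        μ {A | act (A : Matrix (Fin d) (Fin d) ℝ) W ∈ EE d s k} = μ (collisionEvent d φ) := by
  obtain ⟨ε₀, h0, h⟩ := geo hm hc hl hu
  refine ⟨ε₀, h0, fun ε hε d hd μ _ _ W hW => ?_⟩
  obtain ⟨hW1, hW2, hW3⟩ := hW
  have hdpos : (0 : ℝ) < d := by exact_mod_cast (by omega : 0 < d)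
  set P := ∑ i, (W i).1 ^ 2 with hP
  set Q := ∑ i, (W i).2 ^ 2 with hQ
  set R := ∑ i, (W i).1 * (W i).2 with hR
  have hh : ∀ x y : ℝ, |x - d * y| ≤ d * ε → |x / d - y| ≤ ε₀ := by
    intro x y hxy
    have : x / d - y = (x - d * y) / d := by field_simp
    rw [this, abs_div, abs_of_pos hdpos, div_le_iff₀ hdpos]
    nlinarith
  obtain ⟨g1, g2, g3, g4⟩ := h (P / d, Q / d, R / d) (hh _ _ hW1) (hh _ _ hW2)
    (by have := hh R 0 (by simpa using hW3); simpa using this)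
  let X : Fin d → ℝ := fun i => s * (W i).1 - k * (W i).2
  let Y : Fin d → ℝ := fun i => s * (W i).1 + k * (W i).2
  have hXX : X ⬝ᵥ X = s ^ 2 * P + k ^ 2 * Q - 2 * s * k * R := by
    simp only [dotProduct, X, hP, hQ, hR, Finset.mul_sum, ← Finset.sum_add_distrib, ← Finset.sum_sub_distrib]
    exact Finset.sum_congr rfl fun i _ => by ring
  have hYY : Y ⬝ᵥ Y = s ^ 2 * P + k ^ 2 * Q + 2 * s * k * R := by
    simp only [dotProduct, Y, hP, hQ, hR, Finset.mul_sum, ← Finset.sum_add_distrib]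
    exact Finset.sum_congr rfl fun i _ => by ring
  have hXY : X ⬝ᵥ Y = s ^ 2 * P - k ^ 2 * Q := by
    simp only [dotProduct, X, Y, hP, hQ, Finset.mul_sum, ← Finset.sum_sub_distrib]
    exact Finset.sum_congr rfl fun i _ => by ring
  simp only at g3 g4
  have e1 : X ⬝ᵥ X = d * (s ^ 2 * (P / d) + k ^ 2 * (Q / d) - 2 * s * k * (R / d)) := by
    rw [hXX]; field_simp
  have e2 : Y ⬝ᵥ Y = d * (s ^ 2 * (P / d) + k ^ 2 * (Q / d) + 2 * s * k * (R / d)) := by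
    rw [hYY]; field_simp
  have e3 : X ⬝ᵥ Y = d * (s ^ 2 * (P / d) - k ^ 2 * (Q / d)) := by
    rw [hXY]; field_simp
  set x := s ^ 2 * (P / d) + k ^ 2 * (Q / d) - 2 * s * k * (R / d) with hx
  set y := s ^ 2 * (P / d) + k ^ 2 * (Q / d) + 2 * s * k * (R / d) with hy
  set F := FF s k (P / d, Q / d, R / d) with hF
  have hF' : F * (√x * √y) = s ^ 2 * (P / d) - k ^ 2 * (Q / d) := by
    rw [hF]; simp only [FF]; rw [← hx, ← hy]
    have := Real.sqrt_pos.2 g3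
    have := Real.sqrt_pos.2 g4
    field_simp
  have hcos : cos (arccos F) = F := Real.cos_arccos (by linarith) (by linarith)
  have hsx := Real.sqrt_pos.2 g3
  have hsy := Real.sqrt_pos.2 g4
  have hsd := Real.sqrt_pos.2 hdpos
  have hφ0 : 0 < arccos F := Real.arccos_pos.2 (by linarith)
  have hφ1 : arccos F < π := by
    have h1 : arccos F ≤ π := Real.arccos_le_pi F
    refine lt_of_le_of_ne h1 fun h2 => ?_
    rw [h2, cos_pi] at hcos; linarith
  refine ⟨arccos F, hφ0, hφ1, by rw [hcos]; exact g1, by rw [hcos]; exact g2, ?_⟩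
  rw [← coll_eq hd μ X Y (a := √d * √x) (b := √d * √y) (by positivity) (by positivity) 
    (by rw [e1, mul_pow, Real.sq_sqrt hdpos.le, Real.sq_sqrt g3.le])
    (by rw [e2, mul_pow, Real.sq_sqrt hdpos.le, Real.sq_sqrt g4.le])
    (by rw [e3, hcos, ← hF']; linear_combination (-(F * √x * √y)) * Real.mul_self_sqrt hdpos.le) (sin_pos_of_pos_of_lt_pi hφ0 hφ1)]
  congr 1
  ext A
  have hX : X = s • (fun j => (W j).1) - k • (fun j => (W j).2) := by ext j; simp [X]
  have hY : Y = s • (fun j => (W j).1) + k • (fun j => (W j).2) := by ext j; simp [Y]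
  rw [hX, hY]
  simp only [Set.mem_ofPred_eq, EE, Wd, Set.mem_univ_pi, act, Matrix.mulVec_sub, Matrix.mulVec_add, Matrix.mulVec_smul,
    Pi.sub_apply, Pi.add_apply, Pi.smul_apply, smul_eq_mul]

lemma vol_upper {s k τ₁ τ₂ c θ : ℝ} (hm : 0 < s ^ 2 * τ₁ + k ^ 2 * τ₂)
    (hc : s ^ 2 * τ₁ - k ^ 2 * τ₂ = c * (s ^ 2 * τ₁ + k ^ 2 * τ₂)) (h0 : 0 < θ) (h1 : θ < π)
    (hθ : cos θ < c) (hc1 : c < 1) :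
    ∃ ε₀ > 0, ∀ ε ≤ ε₀, ∀ d : ℕ, 2 ≤ d → ∀ μ : Measure (Matrix.orthogonalGroup (Fin d) ℝ),
      IsProbabilityMeasure μ → μ.IsMulLeftInvariant →
      μ (collisionEvent d θ) * volume (SS d τ₁ τ₂ ε) ≤ volume (EE d s k ∩ SS d τ₁ τ₂ ε) := by
  obtain ⟨ε₀, hε₀, h⟩ := angle_exists hm hc hθ hc1 (neg_one_le_cos θ) le_rfl
  refine ⟨ε₀, hε₀, fun ε hε d hd μ i1 i2 => ?_⟩
  rw [averaging μ _ _ (EE_meas d s k) (SS_meas d τ₁ τ₂ ε) (SS_inv τ₁ τ₂ ε), ← setLIntegral_const]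
  refine setLIntegral_mono' (SS_meas d τ₁ τ₂ ε) fun W hW => ?_
  obtain ⟨φ, p0, p1, p2, _, p3⟩ := h ε hε d hd μ i1 i2 W hW
  rw [p3]
  refine measure_mono (coll_mono p0.le ?_ h1)
  by_contra hlt
  push Not at hlt
  exact absurd (cos_lt_cos_of_nonneg_of_le_pi h0.le p1.le hlt) (by linarith)

lemma vol_lower {s k τ₁ τ₂ c θ : ℝ} (hm : 0 < s ^ 2 * τ₁ + k ^ 2 * τ₂)
    (hc : s ^ 2 * τ₁ - k ^ 2 * τ₂ = c * (s ^ 2 * τ₁ + k ^ 2 * τ₂)) (h0 : 0 < θ) (h1 : θ < π)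
    (hθ : c < cos θ) (hc1 : -1 < c) :
    ∃ ε₀ > 0, ∀ ε ≤ ε₀, ∀ d : ℕ, 2 ≤ d → ∀ μ : Measure (Matrix.orthogonalGroup (Fin d) ℝ),
      IsProbabilityMeasure μ → μ.IsMulLeftInvariant →
      volume (EE d s k ∩ SS d τ₁ τ₂ ε) ≤ μ (collisionEvent d θ) * volume (SS d τ₁ τ₂ ε) := by
  obtain ⟨ε₀, hε₀, h⟩ := angle_exists hm hc hc1 hθ le_rfl (cos_le_one θ)
  refine ⟨ε₀, hε₀, fun ε hε d hd μ i1 i2 => ?_⟩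
  rw [averaging μ _ _ (EE_meas d s k) (SS_meas d τ₁ τ₂ ε) (SS_inv τ₁ τ₂ ε), ← setLIntegral_const]
  refine setLIntegral_mono' (SS_meas d τ₁ τ₂ ε) fun W hW => ?_
  obtain ⟨φ, p0, p1, _, p2, p3⟩ := h ε hε d hd μ i1 i2 W hW
  rw [p3]
  refine measure_mono (coll_mono h0.le ?_ p1)
  by_contra hlt
  push Not at hlt
  exact absurd (cos_lt_cos_of_nonneg_of_le_pi p0.le h1.le hlt) (by linarith)

section

open ProbabilityTheory NNReal

lemma cheb {Ω : Type*} [MeasurableSpace Ω] (P : Measure Ω) [IsProbabilityMeasure P] (f : Ω → ℝ)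
    (hf : MemLp f 2 P) (m : ℝ) (hm : ∫ w, f w ∂P = m) {ε : ℝ} (hε : 0 < ε) :
    ∀ᶠ d : ℕ in atTop, Measure.pi (fun _ : Fin d => P) {W | ¬ |∑ i, f (W i) - d * m| ≤ d * ε} ≤ 1 / 6 := by
  have hlim : Tendsto (fun d : ℕ => (Var[f; P] / ε ^ 2) / (d : ℝ)) atTop (nhds 0) :=
    tendsto_const_div_atTop_nhds_zero_nat _
  have he := hlim.eventually (gt_mem_nhds (show (0 : ℝ) < 1 / 6 by norm_num))
  filter_upwards [he, eventually_gt_atTop 0] with d hd hd0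
  have hdpos : (0 : ℝ) < d := by exact_mod_cast hd0
  have hv := variance_sum_pi (ι := Fin d) (μ := fun _ => P) (X := fun _ => f) (fun _ => hf)
  have hmem : MemLp (∑ i : Fin d, fun W : Fin d → Ω => f (W i)) 2 (Measure.pi (fun _ : Fin d => P)) :=
    memLp_finsetSum' _ fun i _ => hf.comp_measurePreserving (measurePreserving_eval (fun _ : Fin d => P) i)
  have hint : ∫ W, (∑ i : Fin d, fun W : Fin d → Ω => f (W i)) W ∂(Measure.pi (fun _ : Fin d => P)) = d * m := by
    simp only [Finset.sum_apply]
    rw [integral_finsetSum]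
    · have : ∀ i : Fin d, ∫ W, f (W i) ∂(Measure.pi (fun _ : Fin d => P)) = m := by
        intro i
        rw [← hm]
        exact integral_comp_eval (μ := fun _ : Fin d => P) (i := i) hf.aestronglyMeasurable
      simp [this]
    · intro i _
      exact (hf.comp_measurePreserving (measurePreserving_eval (fun _ : Fin d => P) i)).integrable (by norm_num)
  have hc := meas_ge_le_variance_div_sq hmem (c := d * ε) (by positivity)
  rw [hint, hv] at hc
  refine (measure_mono ?_).trans (hc.trans ?_)
  · intro W hW
    simp only [Set.mem_ofPred_eq, not_le, Finset.sum_apply] at hW ⊢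
    exact hW.le
  · have : (1 / 6 : ENNReal) = ENNReal.ofReal (1 / 6) := by
      rw [ENNReal.ofReal_div_of_pos (by norm_num)]; simp
    rw [this]
    apply ENNReal.ofReal_le_ofReal
    refine le_trans (le_of_eq ?_) hd.le
    simp
    field_simp

lemma pi_smul_meas {Ω : Type*} [MeasurableSpace Ω] (ρ : Measure Ω) [IsFiniteMeasure ρ] (c : ℝ≥0) (d : ℕ) :
    Measure.pi (fun _ : Fin d => c • ρ) = (c ^ d) • Measure.pi (fun _ : Fin d => ρ) := by
  refine Measure.pi_eq fun s _ => ?_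
  rw [Measure.smul_apply, Measure.pi_pi]
  simp only [Measure.smul_apply, ENNReal.smul_def, smul_eq_mul, Finset.prod_mul_distrib, Finset.prod_const, Finset.card_univ, Fintype.card_fin, ENNReal.coe_pow]

lemma wlln (ρ : Measure (ℝ × ℝ)) [IsFiniteMeasure ρ] {M τ₁ τ₂ : ℝ} (hM : 0 < M)
    (h0 : ρ Set.univ = ENNReal.ofReal M)
    (l1 : MemLp (fun w : ℝ × ℝ => w.1 ^ 2) 2 ρ) (l2 : MemLp (fun w : ℝ × ℝ => w.2 ^ 2) 2 ρ)
    (l3 : MemLp (fun w : ℝ × ℝ => w.1 * w.2) 2 ρ)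
    (m1 : ∫ w, w.1 ^ 2 ∂ρ = M * τ₁) (m2 : ∫ w, w.2 ^ 2 ∂ρ = M * τ₂) (m3 : ∫ w, w.1 * w.2 ∂ρ = 0)
    {ε : ℝ} (hε : 0 < ε) :
    ∀ᶠ d : ℕ in atTop, ENNReal.ofReal (M ^ d / 2) ≤ Measure.pi (fun _ : Fin d => ρ) (SS d τ₁ τ₂ ε) := by
  let c : ℝ≥0 := ⟨M⁻¹, by positivity⟩
  have hc : ((c : ℝ≥0) : ENNReal) = ENNReal.ofReal M⁻¹ := by
    rw [ENNReal.ofReal_eq_coe_nnreal (by positivity)]; rfl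
  have hcr : (c : ℝ) = M⁻¹ := rfl
  let P := c • ρ
  have hP : IsProbabilityMeasure P := by
    constructor
    simp only [P, Measure.smul_apply, ENNReal.smul_def, h0, smul_eq_mul, hc]
    rw [← ENNReal.ofReal_mul (by positivity), inv_mul_cancel₀ hM.ne']; simp
  have hI : ∀ f : ℝ × ℝ → ℝ, ∀ m, ∫ w, f w ∂ρ = M * m → ∫ w, f w ∂P = m := by
    intro f m h
    rw [integral_smul_nnreal_measure, h, NNReal.smul_def, hcr, smul_eq_mul]; field_simp
  have k1 := cheb P (fun w => w.1 ^ 2) (l1.smul_measure (by simp)) τ₁ (hI _ _ m1) hε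
  have k2 := cheb P (fun w => w.2 ^ 2) (l2.smul_measure (by simp)) τ₂ (hI _ _ m2) hε
  have k3 := cheb P (fun w => w.1 * w.2) (l3.smul_measure (by simp)) 0 (hI _ _ (by rw [m3]; ring)) hε
  filter_upwards [k1, k2, k3] with d k1 k2 k3
  have hcompl : Measure.pi (fun _ : Fin d => P) (SS d τ₁ τ₂ ε)ᶜ ≤ 1 / 2 := by
    have hsub : (SS d τ₁ τ₂ ε)ᶜ ⊆ ({W | ¬ |∑ i, (W i).1 ^ 2 - d * τ₁| ≤ d * ε} ∪
      {W | ¬ |∑ i, (W i).2 ^ 2 - d * τ₂| ≤ d * ε}) ∪ {W | ¬ |∑ i, (W i).1 * (W i).2 - d * 0| ≤ d * ε} := by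
      intro W hW
      simp only [SS, Set.mem_compl_iff, Set.mem_ofPred_eq, Set.mem_union] at hW ⊢
      simp only [mul_zero, sub_zero]
      tauto
    refine (measure_mono hsub).trans ((measure_union_le _ _).trans ?_)
    refine (add_le_add ((measure_union_le _ _).trans (add_le_add k1 k2)) k3).trans ?_
    have : (1 / 6 : ENNReal) = ENNReal.ofReal (1 / 6) := by
      rw [ENNReal.ofReal_div_of_pos (by norm_num)]; simp
    have h2 : (1 / 2 : ENNReal) = ENNReal.ofReal (1 / 2) := by
      rw [ENNReal.ofReal_div_of_pos (by norm_num)]; simp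
    rw [this, h2, ← ENNReal.ofReal_add (by norm_num) (by norm_num), ← ENNReal.ofReal_add (by norm_num) (by norm_num)]
    norm_num
  have hS : 1 / 2 ≤ Measure.pi (fun _ : Fin d => P) (SS d τ₁ τ₂ ε) := by
    have h := prob_compl_eq_one_sub (μ := Measure.pi (fun _ : Fin d => P)) (SS_meas d τ₁ τ₂ ε)
    have h' := prob_add_prob_compl (μ := Measure.pi (fun _ : Fin d => P)) (SS_meas d τ₁ τ₂ ε)
    by_contra hlt
    push Not at hlt
    have : Measure.pi (fun _ : Fin d => P) (SS d τ₁ τ₂ ε) + Measure.pi (fun _ : Fin d => P) (SS d τ₁ τ₂ ε)ᶜ < 1 / 2 + 1 / 2 :=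
      ENNReal.add_lt_add_of_lt_of_le (ne_top_of_le_ne_top (by simp) hcompl) hlt hcompl
    rw [h', ENNReal.add_halves] at this
    exact lt_irrefl _ this
  rw [pi_smul_meas, Measure.smul_apply, ENNReal.smul_def, smul_eq_mul, ENNReal.coe_pow, hc] at hS
  calc ENNReal.ofReal (M ^ d / 2) = ENNReal.ofReal M ^ d * (1 / 2) := by
        rw [ENNReal.ofReal_div_of_pos (by norm_num), ENNReal.ofReal_pow hM.le]
        simp [div_eq_mul_inv]
    _ ≤ ENNReal.ofReal M ^ d * (ENNReal.ofReal M⁻¹ ^ d * Measure.pi (fun _ : Fin d => ρ) (SS d τ₁ τ₂ ε)) := by gcongr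
    _ = _ := by
        rw [← mul_assoc, ← mul_pow, ← ENNReal.ofReal_mul hM.le, mul_inv_cancel₀ hM.ne']
        simp

def gam (t₁ t₂ : ℝ≥0) : Measure (ℝ × ℝ) := (gaussianReal 0 t₁).prod (gaussianReal 0 t₂)

instance (t₁ t₂ : ℝ≥0) : IsProbabilityMeasure (gam t₁ t₂) := by unfold gam; infer_instance

def gd (t₁ t₂ : ℝ≥0) (w : ℝ × ℝ) : ℝ := gaussianPDFReal 0 t₁ w.1 * gaussianPDFReal 0 t₂ w.2

lemma gd_nonneg (t₁ t₂ : ℝ≥0) (w : ℝ × ℝ) : 0 ≤ gd t₁ t₂ w :=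
  mul_nonneg (gaussianPDFReal_nonneg _ _ _) (gaussianPDFReal_nonneg _ _ _)

lemma gd_meas (t₁ t₂ : ℝ≥0) : Measurable (gd t₁ t₂) :=
  ((measurable_gaussianPDFReal 0 t₁).comp measurable_fst).mul
    ((measurable_gaussianPDFReal 0 t₂).comp measurable_snd)

lemma gd_int (t₁ t₂ : ℝ≥0) : Integrable (gd t₁ t₂) :=
  (integrable_gaussianPDFReal 0 t₁).mul_prod (integrable_gaussianPDFReal 0 t₂)

lemma gam_density {t₁ t₂ : ℝ≥0} (h1 : t₁ ≠ 0) (h2 : t₂ ≠ 0) :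
    gam t₁ t₂ = volume.withDensity (fun w => ENNReal.ofReal (gd t₁ t₂ w)) := by
  unfold gam
  rw [gaussianReal_of_var_ne_zero _ h1, gaussianReal_of_var_ne_zero _ h2,
    prod_withDensity (measurable_gaussianPDF _ _) (measurable_gaussianPDF _ _)]
  congr 1
  ext w
  simp only [gd, gaussianPDF]
  rw [ENNReal.ofReal_mul (gaussianPDFReal_nonneg _ _ _)]

lemma pi_density {t₁ t₂ : ℝ≥0} (h1 : t₁ ≠ 0) (h2 : t₂ ≠ 0) (d : ℕ) :
    Measure.pi (fun _ : Fin d => gam t₁ t₂) =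
      volume.withDensity (fun W => ENNReal.ofReal (∏ i, gd t₁ t₂ (W i))) := by
  refine Measure.pi_eq fun s hs => ?_
  rw [withDensity_apply _ (MeasurableSet.univ_pi hs), volume_pi, Measure.restrict_pi_pi,
    ← ofReal_integral_eq_lintegral_ofReal, integral_fintype_prod_eq_prod (fun _ => gd t₁ t₂), ENNReal.ofReal_prod_of_nonneg]
  · refine Finset.prod_congr rfl fun i _ => ?_
    rw [gam_density h1 h2, withDensity_apply _ (hs i), ofReal_integral_eq_lintegral_ofReal]
    · exact (gd_int t₁ t₂).integrableOn
    · exact ae_of_all _ (gd_nonneg t₁ t₂)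
  · exact fun i _ => integral_nonneg (gd_nonneg t₁ t₂)
  · exact Integrable.fintype_prod (f := fun _ => gd t₁ t₂) fun i => (gd_int t₁ t₂).integrableOn
  · exact ae_of_all _ fun W => Finset.prod_nonneg fun i _ => gd_nonneg t₁ t₂ _

lemma sand_le {t₁ t₂ : ℝ≥0} (h1 : t₁ ≠ 0) (h2 : t₂ ≠ 0) {d : ℕ} {B : Set (Fin d → ℝ × ℝ)} (hB : MeasurableSet B)
    {K : ℝ} (h : ∀ W ∈ B, ∏ i, gd t₁ t₂ (W i) ≤ K) :
    Measure.pi (fun _ : Fin d => gam t₁ t₂) B ≤ ENNReal.ofReal K * volume B := by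
  rw [pi_density h1 h2, withDensity_apply _ hB, ← setLIntegral_const]
  exact setLIntegral_mono' hB fun W hW => ENNReal.ofReal_le_ofReal (h W hW)

lemma sand_ge {t₁ t₂ : ℝ≥0} (h1 : t₁ ≠ 0) (h2 : t₂ ≠ 0) {d : ℕ} {B : Set (Fin d → ℝ × ℝ)} (hB : MeasurableSet B)
    {K : ℝ} (h : ∀ W ∈ B, K ≤ ∏ i, gd t₁ t₂ (W i)) :
    ENNReal.ofReal K * volume B ≤ Measure.pi (fun _ : Fin d => gam t₁ t₂) B := by
  rw [pi_density h1 h2, withDensity_apply _ hB, ← setLIntegral_const]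
  exact setLIntegral_mono' hB fun W hW => ENNReal.ofReal_le_ofReal (h W hW)

def hh (t₁ t₂ τ₁ τ₂ : ℝ) (ε : ℝ) : ℝ := log (2 * π * √(t₁ * t₂)) + (τ₁ + ε) / (2 * t₁) + (τ₂ + ε) / (2 * t₂)

lemma prod_gd {t₁ t₂ : ℝ≥0} (h1 : t₁ ≠ 0) (h2 : t₂ ≠ 0) {d : ℕ} (W : Fin d → ℝ × ℝ) :
    ∏ i, gd t₁ t₂ (W i) = exp (-(d * log (2 * π * √(t₁ * t₂)) + (∑ i, (W i).1 ^ 2) / (2 * t₁)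
      + (∑ i, (W i).2 ^ 2) / (2 * t₂))) := by
  have p1 : (0 : ℝ) < t₁ := by positivity
  have p2 : (0 : ℝ) < t₂ := by positivity
  have hg : ∀ w, gd t₁ t₂ w = exp (-(log (2 * π * √(t₁ * t₂)) + w.1 ^ 2 / (2 * t₁) + w.2 ^ 2 / (2 * t₂))) := by
    intro w
    have e : √(2 * π * t₁) * √(2 * π * t₂) = 2 * π * √(t₁ * t₂) := by
      rw [← Real.sqrt_mul (by positivity), show 2 * π * (t₁ : ℝ) * (2 * π * t₂) = (2 * π) ^ 2 * (t₁ * t₂) by ring,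
        Real.sqrt_mul (by positivity), Real.sqrt_sq (by positivity)]
    simp only [gd, gaussianPDFReal, sub_zero]
    rw [neg_add, neg_add, exp_add, exp_add, exp_neg (log _), exp_log (by positivity), ← e, mul_inv]
    simp only [neg_div]; ring
  simp_rw [hg]
  rw [← exp_sum, Finset.sum_neg_distrib, Finset.sum_add_distrib, Finset.sum_add_distrib, Finset.sum_div, Finset.sum_div]
  simp

lemma prod_bounds {t₁ t₂ : ℝ≥0} (h1 : t₁ ≠ 0) (h2 : t₂ ≠ 0) {d : ℕ} {τ₁ τ₂ ε : ℝ} {W : Fin d → ℝ × ℝ}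
    (hW : W ∈ SS d τ₁ τ₂ ε) :
    exp (-(d * hh t₁ t₂ τ₁ τ₂ ε)) ≤ ∏ i, gd t₁ t₂ (W i) ∧
      ∏ i, gd t₁ t₂ (W i) ≤ exp (-(d * hh t₁ t₂ τ₁ τ₂ (-ε))) := by
  have p1 : (0 : ℝ) < t₁ := by positivity
  have p2 : (0 : ℝ) < t₂ := by positivity
  obtain ⟨a, b, _⟩ := hW
  rw [abs_le] at a b
  rw [prod_gd h1 h2, exp_le_exp, exp_le_exp, neg_le_neg_iff, neg_le_neg_iff]
  have e : ∀ ε, (d : ℝ) * hh t₁ t₂ τ₁ τ₂ ε = d * log (2 * π * √(t₁ * t₂)) + (d * τ₁ + d * ε) / (2 * t₁) + (d * τ₂ + d * ε) / (2 * t₂) := by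
    intro ε; unfold hh; ring
  rw [e, e]
  constructor
  · gcongr <;> linarith
  · gcongr <;> linarith

lemma memLp_coord1 (t₁ t₂ : ℝ≥0) : MemLp (fun w : ℝ × ℝ => w.1) 4 (gam t₁ t₂) :=
  (memLp_id_gaussianReal' (μ := 0) (v := t₁) 4 (by simp)).comp_fst _

lemma memLp_coord2 (t₁ t₂ : ℝ≥0) : MemLp (fun w : ℝ × ℝ => w.2) 4 (gam t₁ t₂) :=
  (memLp_id_gaussianReal' (μ := 0) (v := t₂) 4 (by simp)).comp_snd _

lemma memLp_mul4 {ρ : Measure (ℝ × ℝ)} {f g : ℝ × ℝ → ℝ} (hf : MemLp f 4 ρ) (hg : MemLp g 4 ρ) :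
    MemLp (fun w => f w * g w) 2 ρ := by
  have : ENNReal.HolderTriple 4 4 2 := ⟨by
    rw [show (4 : ENNReal) = 2 * 2 by norm_num, ENNReal.mul_inv (by simp) (by simp), ← mul_add, ENNReal.inv_two_add_inv_two, mul_one]⟩
  exact hg.mul hf

lemma memLp_q1 (t₁ t₂ : ℝ≥0) : MemLp (fun w : ℝ × ℝ => w.1 ^ 2) 2 (gam t₁ t₂) := by
  simp_rw [pow_two]; exact memLp_mul4 (memLp_coord1 _ _) (memLp_coord1 _ _)

lemma memLp_q2 (t₁ t₂ : ℝ≥0) : MemLp (fun w : ℝ × ℝ => w.2 ^ 2) 2 (gam t₁ t₂) := by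
  simp_rw [pow_two]; exact memLp_mul4 (memLp_coord2 _ _) (memLp_coord2 _ _)

lemma memLp_q3 (t₁ t₂ : ℝ≥0) : MemLp (fun w : ℝ × ℝ => w.1 * w.2) 2 (gam t₁ t₂) :=
  memLp_mul4 (memLp_coord1 _ _) (memLp_coord2 _ _)

lemma gauss_sq (t : ℝ≥0) : ∫ x, x ^ 2 ∂(gaussianReal 0 t) = t := by
  have h := variance_fun_id_gaussianReal (μ := 0) (v := t)
  rw [variance_eq_integral (by fun_prop)] at h
  simpa using h

lemma gam_m1 (t₁ t₂ : ℝ≥0) : ∫ w, w.1 ^ 2 ∂(gam t₁ t₂) = t₁ := by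
  unfold gam
  rw [integral_fun_fst (fun x : ℝ => x ^ 2), gauss_sq]; simp

lemma gam_m2 (t₁ t₂ : ℝ≥0) : ∫ w, w.2 ^ 2 ∂(gam t₁ t₂) = t₂ := by
  unfold gam
  rw [integral_fun_snd (fun x : ℝ => x ^ 2), gauss_sq]; simp

lemma gam_m3 (t₁ t₂ : ℝ≥0) : ∫ w, w.1 * w.2 ∂(gam t₁ t₂) = 0 := by
  unfold gam
  rw [integral_prod_mul (fun x : ℝ => x) (fun x : ℝ => x)]; simp

lemma gam_wlln {t₁ t₂ : ℝ≥0} {ε : ℝ} (hε : 0 < ε) :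
    ∀ᶠ d : ℕ in atTop, ENNReal.ofReal (1 / 2) ≤ Measure.pi (fun _ : Fin d => gam t₁ t₂) (SS d t₁ t₂ ε) := by
  have := wlln (gam t₁ t₂) (M := 1) (τ₁ := t₁) (τ₂ := t₂) one_pos (by simp) (memLp_q1 _ _) (memLp_q2 _ _) (memLp_q3 _ _)
    (by simp [gam_m1]) (by simp [gam_m2]) (gam_m3 _ _) hε
  simpa using this

lemma radial (n : ℕ) : ∫ r in Set.Ioi (0 : ℝ), r ^ (n + 1) * exp (-r ^ 2 / 2) =
    2 ^ ((n : ℝ) / 2) * Gamma ((n : ℝ) / 2 + 1) := by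
  have h := integral_rpow_mul_exp_neg_mul_rpow (p := 2) (q := (n + 1 : ℝ)) (b := 1 / 2) (by norm_num) (by positivity |> lt_trans (by norm_num : (-1 : ℝ) < 0)) (by norm_num)
  have e : ∫ r in Set.Ioi (0 : ℝ), r ^ (n + 1) * exp (-r ^ 2 / 2) = 
    ∫ x in Set.Ioi (0 : ℝ), x ^ ((n : ℝ) + 1) * rexp (-(1 / 2) * x ^ (2 : ℝ)) := by
    refine setIntegral_congr_fun measurableSet_Ioi fun x hx => ?_
    beta_reduce
    rw [show ((n : ℝ) + 1) = ((n + 1 : ℕ) : ℝ) by push_cast; ring, Real.rpow_natCast, show (2 : ℝ) = ((2 : ℕ) : ℝ) by norm_num, Real.rpow_natCast]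
    congr 2; push_cast; ring
  rw [e, h]
  rw [show -((n : ℝ) + 1 + 1) / 2 = -((n : ℝ) / 2 + 1) by ring, one_div, Real.inv_rpow (by norm_num), Real.rpow_neg (by norm_num), inv_inv,
    Real.rpow_add (by norm_num), Real.rpow_one, show ((n : ℝ) + 1 + 1) / 2 = (n : ℝ) / 2 + 1 by ring]
  ring

lemma angular_set {α : ℝ} (h0 : 0 < α) (h1 : α < π / 2) :
    Set.Ioo (-π) π ∩ {φ | (cos φ, sin φ) ∈ Wd (sin α) (cos α)} =
      (Set.Ioc (-α) α ∪ {-α} ∪ Set.Ioo (π - α) π) ∪ Set.Ioo (-π) (α - π) := by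
  ext φ
  have e1 : sin α * cos φ - cos α * sin φ = sin (α - φ) := by rw [sin_sub]
  have e2 : sin α * cos φ + cos α * sin φ = sin (α + φ) := by rw [sin_add]
  simp only [Set.mem_inter_iff, Set.mem_Ioo, Set.mem_ofPred_eq, Wd, e1, e2, Set.mem_union, Set.mem_Ioc, Set.mem_singleton_iff]
  have hneg : ∀ x, -π < x → x < 0 → ¬ 0 ≤ sin x := fun x a b => not_le.2 (sin_neg_of_neg_of_neg_pi_lt b a)
  have hneg2 : ∀ x, π < x → x < 2 * π → ¬ 0 ≤ sin x := by
    intro x a b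
    have := hneg (x - 2 * π) (by linarith) (by linarith)
    rwa [sin_sub_two_pi] at this
  have hpos : ∀ x, 0 ≤ x → x ≤ π → 0 ≤ sin x := fun x a b => sin_nonneg_of_nonneg_of_le_pi a b
  constructor
  · rintro ⟨⟨a, b⟩, h⟩
    by_contra hcon
    push Not at hcon
    obtain ⟨⟨⟨c1, c1'⟩, c2⟩, c3⟩ := hcon
    rcases lt_or_ge φ 0 with hφ | hφ
    · have g1 : φ < -α := by
        by_contra hx; push Not at hx
        rcases hx.eq_or_lt with hx | hx
        · exact c1' hx.symm
        · linarith [c1 hx]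
      have g2 := c3 a
      have q1 := hneg (α + φ) (by linarith) (by linarith)
      have q2 := hpos (α - φ) (by linarith) (by linarith)
      simp [sgn, q1, q2] at h; norm_num at h
    · have g1 := c1 (by linarith)
      have g2 : φ ≤ π - α := by
        by_contra hx; push Not at hx; linarith [c2 hx]
      have q1 := hneg (α - φ) (by linarith) (by linarith)
      have q2 := hpos (α + φ) (by linarith) (by linarith)
      simp [sgn, q1, q2] at h; norm_num at h
  · rintro (((⟨a, b⟩ | a) | ⟨a, b⟩) | ⟨a, b⟩)
    · have q1 := hpos (α - φ) (by linarith) (by linarith)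
      have q2 := hpos (α + φ) (by linarith) (by linarith)
      exact ⟨⟨by linarith, by linarith⟩, by simp [sgn, q1, q2]⟩
    · have q1 := hpos (α - φ) (by linarith) (by linarith)
      have q2 := hpos (α + φ) (by linarith) (by linarith)
      exact ⟨⟨by linarith, by linarith⟩, by simp [sgn, q1, q2]⟩
    · have q1 := hneg (α - φ) (by linarith) (by linarith)
      have q2 := hneg2 (α + φ) (by linarith) (by linarith)
      exact ⟨⟨by linarith, by linarith⟩, by simp [sgn, q1, q2]⟩
    · have q1 := hneg2 (α - φ) (by linarith) (by linarith)
      have q2 := hneg (α + φ) (by linarith) (by linarith)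
      exact ⟨⟨by linarith, by linarith⟩, by simp [sgn, q1, q2]⟩

lemma T_meas (s k : ℝ) : MeasurableSet {φ : ℝ | (cos φ, sin φ) ∈ Wd s k} :=
  (measurable_cos.prodMk measurable_sin) (Wd_meas s k)

lemma angular {α : ℝ} (h0 : 0 < α) (h1 : α < π / 2) (g : ℝ → ℝ) (hg : Continuous g) :
    ∫ φ in Set.Ioo (-π) π, {φ | (cos φ, sin φ) ∈ Wd (sin α) (cos α)}.indicator g φ =
      (∫ φ in (-α)..α, g φ) + (∫ φ in (π - α)..π, g φ) + ∫ φ in (-π)..(α - π), g φ := by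
  have hI : ∀ a b : ℝ, IntegrableOn g (Set.Ioo a b) := fun a b =>
    (hg.integrableOn_Icc (a := a) (b := b)).mono_set Set.Ioo_subset_Icc_self
  have hI' : ∀ a b : ℝ, IntegrableOn g (Set.Ioc a b) := fun a b =>
    (hg.integrableOn_Icc (a := a) (b := b)).mono_set Set.Ioc_subset_Icc_self
  have hIs : IntegrableOn g {-α} := by simp
  rw [setIntegral_indicator (T_meas _ _), angular_set h0 h1, setIntegral_union, setIntegral_union, setIntegral_union]
  · simp only [integral_singleton, Measure.real, measure_singleton, ENNReal.toReal_zero, zero_smul, add_zero]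
    rw [intervalIntegral.integral_of_le (by linarith), intervalIntegral.integral_of_le (by linarith),
      intervalIntegral.integral_of_le (by linarith), integral_Ioc_eq_integral_Ioo (x := π - α), integral_Ioc_eq_integral_Ioo (x := -π)]
  · rw [Set.disjoint_left]; rintro x ⟨a, b⟩ hx; simp at hx; linarith
  · exact measurableSet_singleton _
  · exact hI' _ _
  · exact hIs
  · rw [Set.disjoint_left]; rintro x (⟨a, b⟩ | a) hx
    · linarith [hx.1]
    · simp at a; linarith [hx.1]
  · exact measurableSet_Ioo
  · exact (hI' _ _).union hIs
  · exact hI _ _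
  · rw [Set.disjoint_left]; rintro x ((⟨a, b⟩ | a) | a) hx
    · linarith [hx.2]
    · simp at a; linarith [hx.2]
    · linarith [hx.2, a.1]
  · exact measurableSet_Ioo
  · exact ((hI' _ _).union hIs).union (hI _ _)
  · exact hI _ _

lemma polar_int {s k : ℝ} (f : ℝ × ℝ → ℝ) (n : ℕ) (g : ℝ → ℝ)
    (hfg : ∀ r φ, f (r * cos φ, r * sin φ) = r ^ n * g φ) :
    ∫ w in Wd s k, f w ∂(gam 1 1) = (2 * π)⁻¹ * (2 ^ ((n : ℝ) / 2) * Gamma ((n : ℝ) / 2 + 1)) *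
      ∫ φ in Set.Ioo (-π) π, {φ | (cos φ, sin φ) ∈ Wd s k}.indicator g φ := by
  rw [← integral_indicator (Wd_meas s k), gam_density one_ne_zero one_ne_zero,
    integral_withDensity_eq_integral_toReal_smul (gd_meas 1 1).ennreal_ofReal (by simp),
    ← integral_comp_polarCoord_symm, ← radial, mul_assoc, ← setIntegral_prod_mul, ← integral_const_mul]
  refine setIntegral_congr_fun (measurableSet_Ioi.prod measurableSet_Ioo) ?_
  rintro ⟨r, φ⟩ ⟨hr, -⟩
  have hr : 0 < r := hr
  have hmem : ((r * cos φ, r * sin φ) ∈ Wd s k) ↔ ((cos φ, sin φ) ∈ Wd s k) := by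
    simp only [Wd, Set.mem_ofPred_eq]
    rw [show s * (r * cos φ) - k * (r * sin φ) = r * (s * cos φ - k * sin φ) by ring,
      show s * (r * cos φ) + k * (r * sin φ) = r * (s * cos φ + k * sin φ) by ring, sgn_mul hr, sgn_mul hr]
  have hgd : gd 1 1 (r * cos φ, r * sin φ) = (2 * π)⁻¹ * exp (-r ^ 2 / 2) := by
    simp only [gd, gaussianPDFReal, sub_zero, NNReal.coe_one, mul_one]
    rw [show (√(2 * π))⁻¹ * rexp (-(r * cos φ) ^ 2 / 2) * ((√(2 * π))⁻¹ * rexp (-(r * sin φ) ^ 2 / 2)) =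
      (√(2 * π) * √(2 * π))⁻¹ * (rexp (-(r * cos φ) ^ 2 / 2) * rexp (-(r * sin φ) ^ 2 / 2)) by rw [mul_inv]; ring,
      ← exp_add, Real.mul_self_sqrt (by positivity)]
    congr 2
    linear_combination (-r ^ 2 / 2) * sin_sq_add_cos_sq φ
  simp only [polarCoord_symm_apply, smul_eq_mul]
  rw [ENNReal.toReal_ofReal (gd_nonneg _ _ _), hgd]
  by_cases hw : (cos φ, sin φ) ∈ Wd s k
  · rw [Set.indicator_of_mem (hmem.2 hw), Set.indicator_of_mem (show φ ∈ {φ | (cos φ, sin φ) ∈ Wd s k} from hw), hfg]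
    ring
  · rw [Set.indicator_of_notMem (fun h => hw (hmem.1 h)), Set.indicator_of_notMem (show φ ∉ {φ | (cos φ, sin φ) ∈ Wd s k} from hw)]
    ring

lemma wedge_wlln {A : ℝ} (h0 : 0 < A) (h1 : A < π) {ε : ℝ} (hε : 0 < ε) :
    gam 1 1 (Wd (sin (A / 2)) (cos (A / 2))) = ENNReal.ofReal (A / π) ∧
    ∀ᶠ d : ℕ in atTop, ENNReal.ofReal ((A / π) ^ d / 2) ≤ Measure.pi (fun _ : Fin d => gam 1 1)
      (EE d (sin (A / 2)) (cos (A / 2)) ∩ SS d (1 + sin A / A) (1 - sin A / A) ε) := by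
  set s := sin (A / 2)
  set k := cos (A / 2)
  have ha0 : 0 < A / 2 := by linarith
  have ha1 : A / 2 < π / 2 := by linarith
  have hsin : sin A = 2 * s * k := by rw [← sin_two_mul]; congr 1; ring
  have hpi := Real.pi_pos
  have i0 : (gam 1 1) (Wd s k) = ENNReal.ofReal (A / π) := by
    have h := polar_int (s := s) (k := k) (fun _ => 1) 0 (fun _ => 1) (by simp)
    rw [angular ha0 ha1 _ continuous_const] at h
    simp only [setIntegral_const, smul_eq_mul, mul_one, intervalIntegral.integral_const] at h
    norm_num at h
    rw [← ENNReal.ofReal_toReal (measure_ne_top (gam 1 1) (Wd s k))]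
    congr 1
    rw [Measure.real] at h
    rw [h]; field_simp; ring
  refine ⟨i0, ?_⟩
  have i1 : ∫ w in Wd s k, w.1 ^ 2 ∂(gam 1 1) = A / π * (1 + sin A / A) := by
    rw [polar_int (fun w => w.1 ^ 2) 2 (fun φ => cos φ ^ 2) (by intro r φ; simp [mul_pow]),
      angular ha0 ha1 _ (by fun_prop), integral_cos_sq, integral_cos_sq, integral_cos_sq]
    simp only [cos_neg, sin_neg, cos_pi_sub, sin_pi_sub, cos_pi, sin_pi, cos_sub_pi, sin_sub_pi]
    rw [hsin]; simp [Real.Gamma_two, one_add_one_eq_two]; field_simp; ring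
  have i2 : ∫ w in Wd s k, w.2 ^ 2 ∂(gam 1 1) = A / π * (1 - sin A / A) := by
    rw [polar_int (fun w => w.2 ^ 2) 2 (fun φ => sin φ ^ 2) (by intro r φ; simp [mul_pow]),
      angular ha0 ha1 _ (by fun_prop), integral_sin_sq, integral_sin_sq, integral_sin_sq]
    simp only [cos_neg, sin_neg, cos_pi_sub, sin_pi_sub, cos_pi, sin_pi, cos_sub_pi, sin_sub_pi]
    rw [hsin]; simp [Real.Gamma_two, one_add_one_eq_two]; field_simp; ring
  have i3 : ∫ w in Wd s k, w.1 * w.2 ∂(gam 1 1) = 0 := by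
    rw [polar_int (fun w => w.1 * w.2) 2 (fun φ => sin φ * cos φ) (by intro r φ; simp; ring),
      angular ha0 ha1 _ (by fun_prop), integral_sin_mul_cos₁, integral_sin_mul_cos₁, integral_sin_mul_cos₁]
    simp only [sin_neg, sin_pi_sub, sin_pi, sin_sub_pi]
    ring
  have := wlln ((gam 1 1).restrict (Wd s k)) (M := A / π) (τ₁ := 1 + sin A / A) (τ₂ := 1 - sin A / A) (by positivity)
    (by simp [i0]) ((memLp_q1 _ _).restrict _) ((memLp_q2 _ _).restrict _) ((memLp_q3 _ _).restrict _) i1 i2 i3 hε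
  filter_upwards [this] with d hd
  rw [← Measure.restrict_pi_pi, Measure.restrict_apply (SS_meas _ _ _ _)] at hd
  rw [Set.inter_comm]
  exact hd

def LL (A : ℝ) : ℝ := log (A / π) - log ((1 + sin A / A) * (1 - sin A / A)) / 2

def cc (A : ℝ) : ℝ := (sin A - A * cos A) / (A - sin A * cos A)

lemma sinA_facts {A : ℝ} (h0 : 0 < A) (h1 : A < π) : 0 < sin A / A ∧ sin A / A < 1 := by
  have := sin_pos_of_pos_of_lt_pi h0 h1
  exact ⟨by positivity, by rw [div_lt_one h0]; exact sin_lt h0⟩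

lemma cc_facts {A : ℝ} (h0 : 0 < A) (h1 : A < π) :
    0 < sin (A / 2) ^ 2 * (1 + sin A / A) + cos (A / 2) ^ 2 * (1 - sin A / A) ∧
    sin (A / 2) ^ 2 * (1 + sin A / A) - cos (A / 2) ^ 2 * (1 - sin A / A) =
      cc A * (sin (A / 2) ^ 2 * (1 + sin A / A) + cos (A / 2) ^ 2 * (1 - sin A / A)) := by
  have hs : sin (A / 2) ^ 2 = 1 / 2 - cos A / 2 := by
    rw [sin_sq_eq_half_sub]; congr 2; ring_nf
  have hk : cos (A / 2) ^ 2 = 1 / 2 + cos A / 2 := by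
    rw [cos_sq]; ring_nf
  have hsp := sin_pos_of_pos_of_lt_pi h0 h1
  have hd : 0 < A - sin A * cos A := by
    have := sin_lt h0
    nlinarith [cos_le_one A]
  have e : sin (A / 2) ^ 2 * (1 + sin A / A) + cos (A / 2) ^ 2 * (1 - sin A / A) = (A - sin A * cos A) / A := by
    rw [hs, hk]; field_simp; ring
  rw [e]
  refine ⟨by positivity, ?_⟩
  have hd0 := hd.ne'
  rw [hs, hk]; unfold cc; rw [div_mul_div_cancel₀ hd0]; field_simp; ring

lemma hh_one {A ε : ℝ} : hh 1 1 (1 + sin A / A) (1 - sin A / A) ε = log (2 * π) + 1 + ε := by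
  unfold hh; simp; ring

lemma hh_tau {τ₁ τ₂ ε : ℝ} (h1 : 0 < τ₁) (h2 : 0 < τ₂) :
    hh τ₁ τ₂ τ₁ τ₂ ε = log (2 * π) + log (τ₁ * τ₂) / 2 + 1 + ε * ((1 / τ₁ + 1 / τ₂) / 2) := by
  unfold hh
  rw [log_mul (by positivity) (by positivity), log_sqrt (by positivity)]
  field_simp; ring

lemma SS_fin {τ₁ τ₂ : ℝ≥0} (h1 : τ₁ ≠ 0) (h2 : τ₂ ≠ 0) (d : ℕ) (ε : ℝ) :
    exp (-(d * hh τ₁ τ₂ τ₁ τ₂ ε)) * (volume (SS d τ₁ τ₂ ε)).toReal ≤ 1 ∧ volume (SS d τ₁ τ₂ ε) ≠ ⊤ := by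
  have h := (sand_ge h1 h2 (SS_meas d τ₁ τ₂ ε) (fun W hW => (prod_bounds h1 h2 hW).1)).trans prob_le_one
  have hf : volume (SS d τ₁ τ₂ ε) ≠ ⊤ := by
    intro ht
    rw [ht, ENNReal.mul_top (by simp [exp_pos])] at h
    simp at h
  refine ⟨?_, hf⟩
  have := ENNReal.toReal_mono (by simp) h
  rwa [ENNReal.toReal_mul, ENNReal.toReal_ofReal (exp_pos _).le, ENNReal.toReal_one] at this

lemma key_upper {A θ δ : ℝ} (h0 : 0 < A) (h1 : A < π) (ht0 : 0 < θ) (ht1 : θ < π)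
    (hc : cos θ < cc A) (hc1 : cc A < 1) (hδ : 0 < δ)
    (μ : (d : ℕ) → Measure (Matrix.orthogonalGroup (Fin d) ℝ))
    (hI : ∀ d, (μ d).IsMulLeftInvariant) (hP : ∀ d, IsProbabilityMeasure (μ d)) :
    ∀ᶠ d : ℕ in atTop, collProb d θ (μ d) ≤ exp (d * (LL A + δ)) := by
  obtain ⟨hσ0, hσ1⟩ := sinA_facts h0 h1
  obtain ⟨hm, hcc⟩ := cc_facts h0 h1
  obtain ⟨ε₀, hε₀, H⟩ := vol_upper hm hcc ht0 ht1 hc hc1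
  obtain ⟨τ₁, e1⟩ : ∃ t : ℝ≥0, (t : ℝ) = 1 + sin A / A := ⟨⟨_, by positivity⟩, rfl⟩
  obtain ⟨τ₂, e2⟩ : ∃ t : ℝ≥0, (t : ℝ) = 1 - sin A / A := ⟨⟨_, by linarith⟩, rfl⟩
  have p1 : (0 : ℝ) < τ₁ := by rw [e1]; positivity
  have p2 : (0 : ℝ) < τ₂ := by rw [e2]; linarith
  have n1 : τ₁ ≠ 0 := by rintro rfl; simp at p1
  have n2 : τ₂ ≠ 0 := by rintro rfl; simp at p2
  set κ : ℝ := (1 / τ₁ + 1 / τ₂) / 2 with hκ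
  have hκ0 : 0 < κ := by positivity
  set ε := min ε₀ (δ / 2 / (1 + κ)) with hε
  have hεp : 0 < ε := by positivity
  have hεδ : ε * (1 + κ) ≤ δ / 2 := by
    rw [← le_div_iff₀ (by positivity)]; exact min_le_right _ _
  have hlog : ∀ᶠ d : ℕ in atTop, log 2 / (δ / 2) ≤ d := (tendsto_natCast_atTop_atTop).eventually_ge_atTop _
  filter_upwards [eventually_ge_atTop 2, gam_wlln (t₁ := τ₁) (t₂ := τ₂) hεp, hlog] with d hd hg hl
  have hl' : log 2 ≤ d * (δ / 2) := by rwa [div_le_iff₀ (by positivity)] at hl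
  have HH := H ε (min_le_left _ _) d hd (μ d) (hP d) (hI d)
  rw [← e1, ← e2] at HH
  obtain ⟨-, hfin⟩ := SS_fin n1 n2 d ε
  set S := SS d τ₁ τ₂ ε with hS
  set E := EE d (sin (A / 2)) (cos (A / 2)) with hE
  have hfin2 : volume (E ∩ S) ≠ ⊤ := measure_ne_top_of_subset Set.inter_subset_right hfin
  -- real versions
  have a1 : collProb d θ (μ d) * (volume S).toReal ≤ (volume (E ∩ S)).toReal := by
    have := ENNReal.toReal_mono hfin2 HH
    rwa [ENNReal.toReal_mul] at this
  have a2 : 1 / 2 ≤ exp (-(d * hh τ₁ τ₂ τ₁ τ₂ (-ε))) * (volume S).toReal := by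
    have h := hg.trans (sand_le n1 n2 (SS_meas d τ₁ τ₂ ε) (fun W hW => (prod_bounds n1 n2 hW).2))
    have := ENNReal.toReal_mono (ENNReal.mul_ne_top ENNReal.ofReal_ne_top hfin) h
    rwa [ENNReal.toReal_mul, ENNReal.toReal_ofReal (exp_pos _).le, ENNReal.toReal_ofReal (by norm_num)] at this
  have a3 : exp (-(d * hh 1 1 τ₁ τ₂ ε)) * (volume (E ∩ S)).toReal ≤ (A / π) ^ d := by
    have hpi : Measure.pi (fun _ : Fin d => gam 1 1) E = ENNReal.ofReal ((A / π) ^ d) := by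
      rw [hE]; unfold EE
      rw [Measure.pi_pi]
      simp only [(wedge_wlln h0 h1 hεp).1, Finset.prod_const, Finset.card_univ, Fintype.card_fin]
      rw [← ENNReal.ofReal_pow (by positivity)]
    have hEm : MeasurableSet E := EE_meas d _ _
    have h := ((sand_ge (t₁ := 1) (t₂ := 1) one_ne_zero one_ne_zero (hEm.inter (SS_meas d τ₁ τ₂ ε))
      (fun W hW => (prod_bounds one_ne_zero one_ne_zero hW.2).1)).trans (measure_mono Set.inter_subset_left)).trans hpi.le
    have := ENNReal.toReal_mono (by simp) h
    rw [ENNReal.toReal_mul, ENNReal.toReal_ofReal (exp_pos _).le, ENNReal.toReal_ofReal (by positivity)] at this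
    simpa using this
  set p := collProb d θ (μ d)
  have p0 : 0 ≤ p := ENNReal.toReal_nonneg
  set V := (volume S).toReal
  set U := (volume (E ∩ S)).toReal
  rw [e1, e2, hh_one, exp_neg, inv_mul_le_iff₀ (exp_pos _)] at a3
  rw [hh_tau p1 p2, ← hκ, exp_neg, le_inv_mul_iff₀ (exp_pos _)] at a2
  have hAd : (A / π) ^ d = exp (d * log (A / π)) := by
    rw [mul_comm, exp_mul, exp_log (by positivity), Real.rpow_natCast]
  rw [hAd, ← exp_add] at a3
  have a4 : p * (exp (↑d * (log (2 * π) + log (τ₁ * τ₂) / 2 + 1 + -ε * κ)) * (1 / 2)) ≤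
      exp (↑d * (log (2 * π) + 1 + ε) + d * log (A / π)) :=
    (mul_le_mul_of_nonneg_left a2 p0).trans (a1.trans a3)
  have e2' : exp (-log 2) = 1 / 2 := by rw [exp_neg, exp_log (by norm_num)]; norm_num
  rw [← e2', ← exp_add, ← le_div_iff₀ (exp_pos _), ← exp_sub] at a4
  refine a4.trans (exp_le_exp.2 ?_)
  unfold LL
  rw [← e1, ← e2]
  have := mul_le_mul_of_nonneg_left hεδ (Nat.cast_nonneg (α := ℝ) d)
  nlinarith

lemma key_lower {A θ δ : ℝ} (h0 : 0 < A) (h1 : A < π) (ht0 : 0 < θ) (ht1 : θ < π)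
    (hc : cc A < cos θ) (hc1 : -1 < cc A) (hδ : 0 < δ)
    (μ : (d : ℕ) → Measure (Matrix.orthogonalGroup (Fin d) ℝ))
    (hI : ∀ d, (μ d).IsMulLeftInvariant) (hP : ∀ d, IsProbabilityMeasure (μ d)) :
    ∀ᶠ d : ℕ in atTop, exp (d * (LL A - δ)) ≤ collProb d θ (μ d) := by
  obtain ⟨hσ0, hσ1⟩ := sinA_facts h0 h1
  obtain ⟨hm, hcc⟩ := cc_facts h0 h1
  obtain ⟨ε₀, hε₀, H⟩ := vol_lower hm hcc ht0 ht1 hc hc1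
  obtain ⟨τ₁, e1⟩ : ∃ t : ℝ≥0, (t : ℝ) = 1 + sin A / A := ⟨⟨_, by positivity⟩, rfl⟩
  obtain ⟨τ₂, e2⟩ : ∃ t : ℝ≥0, (t : ℝ) = 1 - sin A / A := ⟨⟨_, by linarith⟩, rfl⟩
  have p1 : (0 : ℝ) < τ₁ := by rw [e1]; positivity
  have p2 : (0 : ℝ) < τ₂ := by rw [e2]; linarith
  have n1 : τ₁ ≠ 0 := by rintro rfl; simp at p1
  have n2 : τ₂ ≠ 0 := by rintro rfl; simp at p2
  set κ : ℝ := (1 / τ₁ + 1 / τ₂) / 2 with hκ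
  have hκ0 : 0 < κ := by positivity
  set ε := min ε₀ (δ / 2 / (1 + κ)) with hε
  have hεp : 0 < ε := by positivity
  have hεδ : ε * (1 + κ) ≤ δ / 2 := by
    rw [← le_div_iff₀ (by positivity)]; exact min_le_right _ _
  have hlog : ∀ᶠ d : ℕ in atTop, log 2 / (δ / 2) ≤ d := (tendsto_natCast_atTop_atTop).eventually_ge_atTop _
  filter_upwards [eventually_ge_atTop 2, (wedge_wlln h0 h1 hεp).2, hlog] with d hd hg hl
  have hl' : log 2 ≤ d * (δ / 2) := by rwa [div_le_iff₀ (by positivity)] at hl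
  have HH := H ε (min_le_left _ _) d hd (μ d) (hP d) (hI d)
  rw [← e1, ← e2] at HH hg
  obtain ⟨a2, hfin⟩ := SS_fin n1 n2 d ε
  set S := SS d τ₁ τ₂ ε with hS
  set E := EE d (sin (A / 2)) (cos (A / 2)) with hE
  have hfin2 : volume (E ∩ S) ≠ ⊤ := measure_ne_top_of_subset Set.inter_subset_right hfin
  have a1 : (volume (E ∩ S)).toReal ≤ collProb d θ (μ d) * (volume S).toReal := by
    have := hP d
    have := ENNReal.toReal_mono (ENNReal.mul_ne_top (measure_ne_top _ _) hfin) HH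
    rwa [ENNReal.toReal_mul] at this
  have a3 : (A / π) ^ d / 2 ≤ exp (-(d * hh 1 1 τ₁ τ₂ (-ε))) * (volume (E ∩ S)).toReal := by
    have h := hg.trans (sand_le (t₁ := 1) (t₂ := 1) one_ne_zero one_ne_zero ((EE_meas d _ _).inter (SS_meas d τ₁ τ₂ ε))
      (fun W hW => (prod_bounds one_ne_zero one_ne_zero hW.2).2))
    have := ENNReal.toReal_mono (ENNReal.mul_ne_top ENNReal.ofReal_ne_top hfin2) h
    rw [ENNReal.toReal_mul, ENNReal.toReal_ofReal (exp_pos _).le, ENNReal.toReal_ofReal (by positivity)] at this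
    simpa using this
  set p := collProb d θ (μ d)
  have p0 : 0 ≤ p := ENNReal.toReal_nonneg
  set V := (volume S).toReal
  set U := (volume (E ∩ S)).toReal
  rw [e1, e2, hh_one, exp_neg, le_inv_mul_iff₀ (exp_pos _)] at a3
  rw [hh_tau p1 p2, ← hκ, exp_neg, inv_mul_le_iff₀ (exp_pos _), mul_one] at a2
  have hAd : (A / π) ^ d = exp (d * log (A / π)) := by
    rw [mul_comm, exp_mul, exp_log (by positivity), Real.rpow_natCast]
  have e2' : exp (-log 2) = 1 / 2 := by rw [exp_neg, exp_log (by norm_num)]; norm_num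
  rw [div_eq_mul_one_div _ (2 : ℝ), hAd, ← e2', ← exp_add, ← exp_add] at a3
  have a4 := a3.trans (a1.trans (mul_le_mul_of_nonneg_left a2 p0))
  rw [← div_le_iff₀ (exp_pos _), ← exp_sub] at a4
  refine le_trans (exp_le_exp.2 ?_) a4
  unfold LL
  rw [← e1, ← e2]
  have := mul_le_mul_of_nonneg_left hεδ (Nat.cast_nonneg (α := ℝ) d)
  nlinarith

end

lemma cc_den {A : ℝ} (h0 : 0 < A) (h1 : A < π) : 0 < A - sin A * cos A := by
  have hsp := sin_pos_of_pos_of_lt_pi h0 h1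
  have := sin_lt h0
  nlinarith [cos_le_one A]

lemma cc_deriv {A : ℝ} (h0 : 0 < A) (h1 : A < π) :
    HasDerivAt cc ((A * sin A * (A - sin A * cos A) - (sin A - A * cos A) * (2 * sin A ^ 2)) /
      (A - sin A * cos A) ^ 2) A := by
  have hd := cc_den h0 h1
  have n : HasDerivAt (fun A => sin A - A * cos A) (A * sin A) A := by
    have := (hasDerivAt_sin A).sub ((hasDerivAt_id A).mul (hasDerivAt_cos A))
    refine HasDerivAt.congr_deriv this ?_
    simp
  have e : HasDerivAt (fun A => A - sin A * cos A) (2 * sin A ^ 2) A := by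
    have := (hasDerivAt_id A).sub ((hasDerivAt_sin A).mul (hasDerivAt_cos A))
    refine HasDerivAt.congr_deriv this ?_
    nlinarith [sin_sq_add_cos_sq A]
  exact n.div e hd.ne'

lemma cc_mono : StrictMonoOn cc (Set.Ioo (π / 2) π) := by
  have hb : ∀ A ∈ Set.Ioo (π / 2) π, 0 < A ∧ A < π := fun A hA => ⟨by have := pi_pos; linarith [hA.1], hA.2⟩
  refine strictMonoOn_of_deriv_pos (convex_Ioo _ _) ?_ ?_
  · exact fun A hA => (cc_deriv (hb A hA).1 (hb A hA).2).continuousAt.continuousWithinAt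
  · intro A hA
    rw [interior_Ioo] at hA
    obtain ⟨h0, h1⟩ := hb A hA
    rw [(cc_deriv h0 h1).deriv]
    have hd := cc_den h0 h1
    have hs := sin_pos_of_pos_of_lt_pi h0 h1
    have hA2 : 3 / 2 < A := by have := pi_gt_three; linarith [hA.1]
    have hsc := sin_sq_add_cos_sq A
    have key : 0 < A ^ 2 + A * (sin A * cos A) - 2 * sin A ^ 2 := by
      have huv := sin_sq_add_cos_sq (2 * A)
      have hu : sin (2 * A) = 2 * sin A * cos A := sin_two_mul A
      have hv : cos (2 * A) = 1 - 2 * sin A ^ 2 := by rw [cos_two_mul]; linarith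
      set u := sin (2 * A)
      set v := cos (2 * A)
      have h2 : 9 / 4 < A ^ 2 := by nlinarith
      have hsq : (A / 2 * u + v) ^ 2 < (A ^ 2 - 1) ^ 2 := by
        have c1 : (A / 2 * u + v) ^ 2 ≤ (A ^ 2 / 4 + 1) * (u ^ 2 + v ^ 2) := by
          nlinarith [sq_nonneg (A / 2 * v - u)]
        rw [huv] at c1
        nlinarith [mul_pos (show 0 < A ^ 2 by positivity) (sub_pos.2 h2)]
      have := (abs_lt_of_sq_lt_sq' hsq (by linarith)).1
      nlinarith
    have : A * sin A * (A - sin A * cos A) - (sin A - A * cos A) * (2 * sin A ^ 2) =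
        sin A * (A ^ 2 + A * (sin A * cos A) - 2 * sin A ^ 2) := by ring
    rw [this]; positivity

lemma LL_cont {A : ℝ} (h0 : 0 < A) (h1 : A < π) : ContinuousAt LL A := by
  obtain ⟨a, b⟩ := sinA_facts h0 h1
  have hQ : (1 + sin A / A) * (1 - sin A / A) ≠ 0 := by
    have : 0 < 1 - sin A / A := by linarith
    positivity
  have hA : A / π ≠ 0 := by positivity
  have hA' : A ≠ 0 := h0.ne'
  unfold LL
  fun_prop (disch := assumption)

lemma limit_of {A θ : ℝ} (hA : A ∈ Set.Ioo (π / 2) π) (ht0 : 0 < θ) (ht1 : θ < π)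
    (hc : cc A = cos θ)
    (μ : (d : ℕ) → Measure (Matrix.orthogonalGroup (Fin d) ℝ))
    (hI : ∀ d, (μ d).IsMulLeftInvariant) (hP : ∀ d, IsProbabilityMeasure (μ d)) :
    Tendsto (fun d : ℕ => (1 / (d : ℝ)) * log (collProb d θ (μ d))) atTop (nhds (LL A)) := by
  have h0 : 0 < A := by have := pi_pos; linarith [hA.1]
  have h1 := hA.2
  have hcA := (cc_deriv h0 h1).continuousAt
  have hLA := LL_cont h0 h1
  have hcl : cos θ < 1 := by
    have := cos_lt_cos_of_nonneg_of_le_pi le_rfl ht1.le ht0; simpa using this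
  have hcg : -1 < cos θ := by
    have := cos_lt_cos_of_nonneg_of_le_pi ht0.le le_rfl ht1; simpa using this
  have hIoo : ∀ᶠ x in nhds A, x ∈ Set.Ioo (π / 2) π := isOpen_Ioo.mem_nhds hA
  rw [Metric.tendsto_nhds]
  intro δ hδ
  have hL1 : ∀ᶠ x in nhds A, |LL x - LL A| < δ / 3 := by
    have := Metric.tendsto_nhds.1 hLA.tendsto (δ / 3) (by positivity)
    simpa [Real.dist_eq] using this
  have hc1 : ∀ᶠ x in nhds A, cc x < 1 := hcA.eventually (gt_mem_nhds (by rw [hc]; exact hcl))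
  have hc2 : ∀ᶠ x in nhds A, -1 < cc x := hcA.eventually (lt_mem_nhds (by rw [hc]; exact hcg))
  have hall := hIoo.and (hL1.and (hc1.and hc2))
  obtain ⟨B, hB, hBI, hBL, -, hB2⟩ := ((eventually_mem_nhdsWithin (s := Set.Iio A)).and
    (hall.filter_mono (nhdsWithin_le_nhds (s := Set.Iio A)))).exists
  obtain ⟨C, hC, hCI, hCL, hC1, -⟩ := ((eventually_mem_nhdsWithin (s := Set.Ioi A)).and
    (hall.filter_mono (nhdsWithin_le_nhds (s := Set.Ioi A)))).exists
  have hB0 : 0 < B := by have := pi_pos; linarith [hBI.1]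
  have hC0 : 0 < C := by have := pi_pos; linarith [hCI.1]
  have lo := key_lower hB0 hBI.2 ht0 ht1 (by rw [← hc]; exact cc_mono hBI hA hB) hB2
    (δ := δ / 3) (by positivity) μ hI hP
  have up := key_upper hC0 hCI.2 ht0 ht1 (by rw [← hc]; exact cc_mono hA hCI hC) hC1
    (δ := δ / 3) (by positivity) μ hI hP
  filter_upwards [lo, up, eventually_gt_atTop 0] with d hl hu hd
  have hd' : (0 : ℝ) < d := by exact_mod_cast hd
  have pp : 0 < collProb d θ (μ d) := (exp_pos _).trans_le hl
  have l1 := (le_log_iff_exp_le pp).2 hl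
  have l2 := (log_le_iff_le_exp pp).2 hu
  rw [abs_lt] at hBL hCL
  rw [Real.dist_eq, abs_lt, one_div, inv_mul_eq_div]
  have m1 : LL B - δ / 3 ≤ log (collProb d θ (μ d)) / d := by
    rw [le_div_iff₀ hd']; linarith
  have m2 : log (collProb d θ (μ d)) / d ≤ LL C + δ / 3 := by
    rw [div_le_iff₀ hd']; linarith
  constructor <;> linarith [hBL.1, hCL.2]

lemma final_alg {β c s r A : ℝ} (hβ : 1 < β) (hg : 1 < β * c) (hs : 0 < s) (hsc : s ^ 2 + c ^ 2 = 1)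
    (hr : 0 < r) (hr2 : r ^ 2 = β ^ 2 - 1) (hA : A = (β - c) * r / (β * (β * c - 1)))
    (hcos : cos A = -1 / β) (hsin : sin A = r / β) (hAp : 0 < A) (hA1 : A < π) :
    cc A = c ∧ LL A = log ((β - c) ^ 2 / (π * β * (β * c - 1) * s)) := by
  have hβ0 : 0 < β := by linarith
  have hg0 : 0 < β * c - 1 := by linarith
  have hg1 := hg0.ne'
  have hc1 : c < 1 := by nlinarith
  have hbc : 0 < β - c := by linarith
  have hAmul : A * (β * (β * c - 1)) = (β - c) * r := by rw [hA]; field_simp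
  constructor
  · have hd := cc_den hAp hA1
    unfold cc
    rw [div_eq_iff hd.ne', hcos, hsin]
    field_simp
    nlinarith [hAmul]
  · obtain ⟨a, b⟩ := sinA_facts hAp hA1
    have hQ : (1 + sin A / A) * (1 - sin A / A) = (r ^ 2 * s / (β * (β * c - 1) * A)) ^ 2 := by
      have e1 : A ^ 2 * (β * (β * c - 1)) ^ 2 = (β - c) ^ 2 * r ^ 2 := by
        rw [← mul_pow, hAmul, mul_pow]
      have hss : s ^ 2 = 1 - c ^ 2 := by linarith
      rw [hsin]
      rw [show (r ^ 2 * s / (β * (β * c - 1) * A)) ^ 2 = r ^ 2 * (r ^ 2 * s ^ 2) / (A ^ 2 * (β * (β * c - 1)) ^ 2) by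
        field_simp, hss]
      rw [eq_div_iff (by positivity)]
      have : (1 + r / β / A) * (1 - r / β / A) = (A ^ 2 * β ^ 2 - r ^ 2) / (A ^ 2 * β ^ 2) := by
        field_simp; ring
      rw [this, div_mul_eq_mul_div, div_eq_iff (by positivity)]
      have e3 : (A ^ 2 * β ^ 2) * (β * c - 1) ^ 2 = (β - c) ^ 2 * r ^ 2 := by rw [← e1]; ring
      have e4 : (A ^ 2 * β ^ 2 - r ^ 2) * (β * c - 1) ^ 2 = r ^ 2 * (r ^ 2 * (1 - c ^ 2)) := by
        rw [sub_mul, e3, hr2]; ring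
      linear_combination (A ^ 2 * β ^ 2) * e4
    unfold LL
    rw [hQ, log_pow]
    have : A / π = ((β - c) ^ 2 / (π * β * (β * c - 1) * s)) * (r ^ 2 * s / (β * (β * c - 1) * A)) := by
      have e1 : A ^ 2 * (β * (β * c - 1)) ^ 2 = (β - c) ^ 2 * r ^ 2 := by
        rw [← mul_pow, hAmul, mul_pow]
      have hp := pi_pos
      rw [div_mul_div_comm, div_eq_div_iff (by positivity) (by positivity)]
      linear_combination (π * s) * e1
    rw [this, log_mul (by positivity) (by positivity)]
    push_cast; ring

theorem hypercube_lsh_collision_exponent_small_angle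
    (θ : ℝ) (hθ : θ ∈ Set.Ioo 0 (Real.arccos (2 / π)))
    (β₀ : ℝ) (hβ₀ : 1 < β₀) (hβ₀c : 1 < β₀ * Real.cos θ)
    (heq : Real.arccos (-1 / β₀)
      = (β₀ - Real.cos θ) * Real.sqrt (β₀ ^ 2 - 1) / (β₀ * (β₀ * Real.cos θ - 1)))
    (μ : (d : ℕ) → Measure (Matrix.orthogonalGroup (Fin d) ℝ))
    (hHaar : ∀ d, (μ d).IsHaarMeasure)
    (hProb : ∀ d, IsProbabilityMeasure (μ d)) :
    Tendsto (fun d : ℕ => (1 / (d : ℝ)) * Real.log (collProb d θ (μ d))) atTop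
      (nhds (Real.log
        ((β₀ - Real.cos θ) ^ 2 / (π * β₀ * (β₀ * Real.cos θ - 1) * Real.sin θ)))) := by
  have ht0 : 0 < θ := hθ.1
  have ht1 : θ < π := hθ.2.trans_le (arccos_le_pi _)
  have hβ0 : 0 < β₀ := by linarith
  have hlt : -1 < -1 / β₀ := by rw [lt_div_iff₀ hβ0]; linarith
  have hneg : -1 / β₀ < 0 := div_neg_of_neg_of_pos (by norm_num) hβ0
  have hr2 : Real.sqrt (β₀ ^ 2 - 1) ^ 2 = β₀ ^ 2 - 1 := sq_sqrt (by nlinarith)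
  have hr : 0 < Real.sqrt (β₀ ^ 2 - 1) := sqrt_pos.2 (by nlinarith)
  have hcos : cos (arccos (-1 / β₀)) = -1 / β₀ := cos_arccos hlt.le (by linarith)
  have hsin : sin (arccos (-1 / β₀)) = Real.sqrt (β₀ ^ 2 - 1) / β₀ := by
    rw [sin_arccos, show 1 - (-1 / β₀) ^ 2 = (β₀ ^ 2 - 1) / β₀ ^ 2 by field_simp, sqrt_div (by nlinarith),
      sqrt_sq hβ0.le]
  have hA1 : π / 2 < arccos (-1 / β₀) := by
    have := strictAntiOn_arccos ⟨hlt.le, by linarith⟩ (show (0 : ℝ) ∈ Set.Icc (-1) 1 by norm_num) hneg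
    simpa using this
  have hA2 : arccos (-1 / β₀) < π := by
    have := strictAntiOn_arccos (show (-1 : ℝ) ∈ Set.Icc (-1) 1 by norm_num) ⟨hlt.le, by linarith⟩ hlt
    simpa using this
  obtain ⟨hc, hL⟩ := final_alg hβ₀ hβ₀c (sin_pos_of_pos_of_lt_pi ht0 ht1) (sin_sq_add_cos_sq θ) hr hr2 heq
    hcos hsin (by have := pi_pos; linarith) hA2
  rw [← hL]
  exact limit_of ⟨hA1, hA2⟩ ht0 ht1 hc μ (fun d => (hHaar d).toIsMulLeftInvariant) hProb
end
end

section
/- Let d ≥ 2 and θ ∈ [π/2, π]. Then the hypercube-LSH collision probability is exactly zero: p_d(θ) = 0. (Indeed, a collision forces (Ax)_i·(Ay)_i ≥ 0 for every coordinate i while the sum of these products equals cos θ ≤ 0, an event of Haar measure zero.) -/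
open MeasureTheory Real Filter

noncomputable section

theorem aux_compact (d : ℕ) : CompactSpace (Matrix.orthogonalGroup (Fin d) ℝ) := by
  refine isCompact_iff_compactSpace.mp (?_ : IsCompact
    ((Matrix.orthogonalGroup (Fin d) ℝ : Submonoid _) : Set (Matrix (Fin d) (Fin d) ℝ)))
  have hK : IsCompact (Set.pi Set.univ (fun _ : Fin d => Set.pi Set.univ
      (fun _ : Fin d => Set.Icc (-1 : ℝ) 1))) :=
    isCompact_univ_pi fun _ => isCompact_univ_pi fun _ => isCompact_Icc
  refine IsCompact.of_isClosed_subset hK ?_ ?_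
  · have : ((Matrix.orthogonalGroup (Fin d) ℝ : Submonoid _) : Set (Matrix (Fin d) (Fin d) ℝ))
        = {A | A * A.transpose = 1} := by
      ext A; exact Matrix.mem_orthogonalGroup_iff (Fin d) ℝ
    rw [this]
    exact isClosed_eq (by fun_prop) (by fun_prop)
  · intro A hA i _ j _
    have := entry_norm_bound_of_unitary hA i j
    rw [Real.norm_eq_abs] at this
    exact abs_le.mp this

theorem aux_borel (d : ℕ) : BorelSpace (Matrix.orthogonalGroup (Fin d) ℝ) := by
  have : BorelSpace (Matrix (Fin d) (Fin d) ℝ) :=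
    inferInstanceAs (BorelSpace (Fin d → Fin d → ℝ))
  exact Subtype.borelSpace _

theorem aux_second (d : ℕ) : SecondCountableTopology (Matrix.orthogonalGroup (Fin d) ℝ) := by
  have : SecondCountableTopology (Matrix (Fin d) (Fin d) ℝ) :=
    inferInstanceAs (SecondCountableTopology (Fin d → Fin d → ℝ))
  exact TopologicalSpace.Subtype.secondCountableTopology _

theorem aux_right (d : ℕ) (μ : Measure (Matrix.orthogonalGroup (Fin d) ℝ))
    (hHaar : μ.IsHaarMeasure) (hProb : IsProbabilityMeasure μ)
    (g : Matrix.orthogonalGroup (Fin d) ℝ) (s : Set (Matrix.orthogonalGroup (Fin d) ℝ))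
    (hs : MeasurableSet s) :
    μ ((fun A => A * g) ⁻¹' s) = μ s := by
  have := aux_compact d
  have := aux_borel d
  have := aux_second d
  have hm : Measurable (fun A : Matrix.orthogonalGroup (Fin d) ℝ => A * g) :=
    (continuous_mul_const g).measurable
  have h1 : IsProbabilityMeasure (μ.map (fun A => A * g)) :=
    Measure.isProbabilityMeasure_map hm.aemeasurable
  have h2 : (μ.map (fun A => A * g)).IsHaarMeasure := Measure.isHaarMeasure_map_mul_right μ g
  have h3 : μ.map (fun A => A * g) = μ := Measure.isHaarMeasure_eq_of_isProbabilityMeasure _ _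
  rw [← Measure.map_apply hm hs, h3]

/-- Householder reflection. -/
def hrefl (d : ℕ) (v : Fin d → ℝ) : Matrix (Fin d) (Fin d) ℝ :=
  1 - (2 : ℝ) • Matrix.vecMulVec v v

theorem refl_mem (d : ℕ) (v : Fin d → ℝ) (hv : v ⬝ᵥ v = 1) :
    hrefl d v ∈ Matrix.orthogonalGroup (Fin d) ℝ := by
  rw [Matrix.mem_orthogonalGroup_iff]
  have h : (hrefl d v).transpose = hrefl d v := by
    simp [hrefl, Matrix.transpose_vecMulVec]
  have h2 : Matrix.vecMulVec v v * Matrix.vecMulVec v v = Matrix.vecMulVec v v := by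
    rw [Matrix.vecMulVec_mul_vecMulVec, hv]; simp
  rw [h, hrefl]
  simp only [sub_mul, mul_sub, one_mul, mul_one, smul_mul_assoc, mul_smul_comm, h2]
  module

theorem mul_refl_apply (d : ℕ) (A : Matrix (Fin d) (Fin d) ℝ) (v : Fin d → ℝ) (i j : Fin d) :
    (A * hrefl d v) i j = A i j - 2 * (A.mulVec v i * v j) := by
  simp [hrefl, mul_sub, Matrix.mul_vecMulVec, Matrix.vecMulVec_apply]

/-- The vector `a e₁ + b e₂`. -/
def vv (d : ℕ) (a b : ℝ) : Fin d → ℝ :=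
  fun i => if (i : ℕ) = 0 then a else if (i : ℕ) = 1 then b else 0

theorem sum_vv (d : ℕ) (hd : 2 ≤ d) (a b : ℝ) (f : Fin d → ℝ) :
    f ⬝ᵥ vv d a b = f ⟨0, by omega⟩ * a + f ⟨1, by omega⟩ * b := by
  obtain ⟨n, rfl⟩ := Nat.exists_eq_add_of_le' hd
  simp [dotProduct, Fin.sum_univ_succ, vv]

theorem aux_trig (s t x y : ℝ) (hs : Real.sin (4 * s - 4 * t) ≠ 0)
    (h1 : (x - 2 * ((x * cos s + y * sin s) * cos s)) *
      (y - 2 * ((x * cos s + y * sin s) * sin s)) = 0)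
    (h2 : (x - 2 * ((x * cos t + y * sin t) * cos t)) *
      (y - 2 * ((x * cos t + y * sin t) * sin t)) = 0) : x = 0 := by
  have key : ∀ s : ℝ, (x - 2 * ((x * cos s + y * sin s) * cos s)) *
      (y - 2 * ((x * cos s + y * sin s) * sin s)) = 0 →
      sin (4 * s) * (x ^ 2 - y ^ 2) - 2 * cos (4 * s) * (x * y) = 0 := by
    intro s h
    have e : 4 * s = 2 * (2 * s) := by ring
    rw [e, Real.sin_two_mul, Real.cos_two_mul (2 * s), Real.sin_two_mul s, Real.cos_two_mul s]
    have e2 := Real.sin_sq_add_cos_sq s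
    have e3 : sin s ^ 2 = 1 - cos s ^ 2 := by linarith
    have e4 : x - 2 * ((x * cos s + y * sin s) * cos s) =
      -(x * (2 * cos s ^ 2 - 1) + y * (2 * sin s * cos s)) := by ring
    have e5 : y - 2 * ((x * cos s + y * sin s) * sin s) =
      -(x * (2 * sin s * cos s) - y * (2 * cos s ^ 2 - 1)) := by
      linear_combination (-2 * y) * e3
    rw [e4, e5] at h
    have e6 : (2 * sin s * cos s) ^ 2 + (2 * cos s ^ 2 - 1) ^ 2 = 1 := by
      rw [← Real.sin_two_mul, ← Real.cos_two_mul]; exact Real.sin_sq_add_cos_sq _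
    linear_combination 2 * h - 2 * x * y * e6
  have k1 := key s h1
  have k2 := key t h2
  rw [Real.sin_sub] at hs
  have a1 : x * y = 0 := by
    have : (sin (4 * s) * cos (4 * t) - cos (4 * s) * sin (4 * t)) * (x * y) = 0 := by
      linear_combination (sin (4 * t) * k1 - sin (4 * s) * k2) / 2
    exact (mul_eq_zero.mp this).resolve_left hs
  have a2 : x ^ 2 - y ^ 2 = 0 := by
    have : (sin (4 * s) * cos (4 * t) - cos (4 * s) * sin (4 * t)) * (x ^ 2 - y ^ 2) = 0 := by
      linear_combination cos (4 * t) * k1 - cos (4 * s) * k2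
    exact (mul_eq_zero.mp this).resolve_left hs
  rcases mul_eq_zero.mp a1 with h | h
  · exact h
  · rw [h] at a2; simpa using a2

theorem aux_null (d : ℕ) (hd : 2 ≤ d) (μ : Measure (Matrix.orthogonalGroup (Fin d) ℝ))
    (hHaar : μ.IsHaarMeasure) (hProb : IsProbabilityMeasure μ) :
    μ {A | ∀ i : Fin d, (A : Matrix (Fin d) (Fin d) ℝ) i ⟨0, by omega⟩ *
      (A : Matrix (Fin d) (Fin d) ℝ) i ⟨1, by omega⟩ = 0} = 0 := by
  have := aux_borel d
  have := aux_second d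
  set E : Set (Matrix.orthogonalGroup (Fin d) ℝ) :=
    {A | ∀ i : Fin d, (A : Matrix (Fin d) (Fin d) ℝ) i ⟨0, by omega⟩ *
      (A : Matrix (Fin d) (Fin d) ℝ) i ⟨1, by omega⟩ = 0} with hE
  have hc : ∀ i j : Fin d, Continuous
      (fun A : Matrix.orthogonalGroup (Fin d) ℝ => (A : Matrix (Fin d) (Fin d) ℝ) i j) :=
    fun i j => continuous_subtype_val.matrix_elem i j
  have hEm : MeasurableSet E := by
    apply IsClosed.measurableSet
    rw [hE, Set.ofPred_forall]
    exact isClosed_iInter fun i => isClosed_eq ((hc _ _).mul (hc _ _)) continuous_const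
  let s : ℕ → ℝ := fun n => 1 / (2 * ((n : ℝ) + 1))
  have hsin : ∀ m n, m ≠ n → Real.sin (4 * s m - 4 * s n) ≠ 0 := by
    intro m n hmn h0
    have hb : ∀ k, 0 < 4 * s k ∧ 4 * s k ≤ 2 := by
      intro k
      have : (0 : ℝ) ≤ k := Nat.cast_nonneg k
      refine ⟨by positivity, ?_⟩
      have : s k ≤ 1 / 2 := by
        apply one_div_le_one_div_of_le <;> linarith
      linarith
    have hm := hb m
    have hn := hb n
    have hpi := Real.pi_gt_three
    rw [Real.sin_eq_zero_iff_of_lt_of_lt (by linarith) (by linarith)] at h0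
    have h1 : s m = s n := by linarith
    simp only [s] at h1
    field_simp at h1
    apply hmn
    have : (m : ℝ) = n := by linarith
    exact_mod_cast this
  have hv : ∀ t : ℝ, vv d (cos t) (sin t) ⬝ᵥ vv d (cos t) (sin t) = 1 := by
    intro t
    rw [sum_vv d hd]
    simp only [vv]
    simp
    nlinarith [Real.sin_sq_add_cos_sq t]
  let R : ℕ → Matrix.orthogonalGroup (Fin d) ℝ :=
    fun n => ⟨hrefl d (vv d (cos (s n)) (sin (s n))), refl_mem d _ (hv _)⟩
  let As : ℕ → Set (Matrix.orthogonalGroup (Fin d) ℝ) := fun n => (fun A => A * R n) ⁻¹' E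
  have hAs : ∀ n, μ (As n) = μ E := fun n => aux_right d μ hHaar hProb (R n) E hEm
  have hAm : ∀ n, MeasurableSet (As n) := fun n =>
    (continuous_mul_const (R n)).measurable hEm
  have hmem : ∀ n A, A ∈ As n → ∀ i,
      ((A : Matrix (Fin d) (Fin d) ℝ) i ⟨0, by omega⟩ - 2 *
        (((A : Matrix (Fin d) (Fin d) ℝ) i ⟨0, by omega⟩ * cos (s n) +
        (A : Matrix (Fin d) (Fin d) ℝ) i ⟨1, by omega⟩ * sin (s n)) * cos (s n))) *
      ((A : Matrix (Fin d) (Fin d) ℝ) i ⟨1, by omega⟩ - 2 *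
        (((A : Matrix (Fin d) (Fin d) ℝ) i ⟨0, by omega⟩ * cos (s n) +
        (A : Matrix (Fin d) (Fin d) ℝ) i ⟨1, by omega⟩ * sin (s n)) * sin (s n))) = 0 := by
    intro n A hA i
    have h := hA i
    have hR : ((A * R n : Matrix.orthogonalGroup (Fin d) ℝ) : Matrix (Fin d) (Fin d) ℝ) =
      (A : Matrix (Fin d) (Fin d) ℝ) * hrefl d (vv d (cos (s n)) (sin (s n))) := rfl
    simp only [hR, mul_refl_apply, Matrix.mulVec, sum_vv d hd] at h
    simpa [vv] using h
  have hdisj : Pairwise (Function.onFun Disjoint As) := by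
    intro m n hmn
    rw [Function.onFun, Set.disjoint_left]
    intro A hm hn
    have hz : ∀ i, (A : Matrix (Fin d) (Fin d) ℝ) i ⟨0, by omega⟩ = 0 := fun i =>
      aux_trig (s m) (s n) _ _ (hsin m n hmn) (hmem m A hm i) (hmem n A hn i)
    have h1 := (Matrix.mem_orthogonalGroup_iff' (Fin d) ℝ).mp A.2
    have h2 := congrFun (congrFun h1 ⟨0, by omega⟩) ⟨0, by omega⟩
    rw [Matrix.mul_apply] at h2
    simp [hz] at h2
  by_contra hne
  have hfin := Measure.finite_const_le_meas_of_disjoint_iUnion μ (pos_iff_ne_zero.mpr hne)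
    hAm hdisj (measure_ne_top _ _)
  simp only [hAs, le_refl] at hfin
  exact Set.infinite_univ hfin

theorem aux_sgn (a b : ℝ) (h : sgn a = sgn b) : 0 ≤ a * b := by
  unfold sgn at h
  split_ifs at h with h1 h2 h2
  · exact mul_nonneg h1 h2
  · norm_num at h
  · norm_num at h
  · exact mul_nonneg_of_nonpos_of_nonpos (by linarith) (by linarith)

theorem hypercube_lsh_collision_prob_zero_obtuse
    (d : ℕ) (hd : 2 ≤ d) (θ : ℝ) (hθ : θ ∈ Set.Icc (π / 2) π)
    (μ : Measure (Matrix.orthogonalGroup (Fin d) ℝ))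
    (hHaar : μ.IsHaarMeasure) (hProb : IsProbabilityMeasure μ) :
    collProb d θ μ = 0 := by
  have hsub : collisionEvent d θ ⊆ {A | ∀ i : Fin d,
      (A : Matrix (Fin d) (Fin d) ℝ) i ⟨0, by omega⟩ *
      (A : Matrix (Fin d) (Fin d) ℝ) i ⟨1, by omega⟩ = 0} := by
    intro A hA
    have hx : xvec d = vv d 1 0 := by
      ext i; simp [xvec, vv]
    have hy : yvec d θ = vv d (cos θ) (sin θ) := rfl
    have hcos : cos θ ≤ 0 := Real.cos_nonpos_of_pi_div_two_le_of_le hθ.1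
      (by linarith [hθ.2, Real.pi_pos])
    have hnn : ∀ i, 0 ≤ (A : Matrix (Fin d) (Fin d) ℝ).mulVec (xvec d) i *
        (A : Matrix (Fin d) (Fin d) ℝ).mulVec (yvec d θ) i := fun i => aux_sgn _ _ (hA i)
    have h1 : (A : Matrix (Fin d) (Fin d) ℝ).transpose * (A : Matrix (Fin d) (Fin d) ℝ) = 1 :=
      (Matrix.mem_orthogonalGroup_iff' (Fin d) ℝ).mp A.2
    have hsum : ∑ i, (A : Matrix (Fin d) (Fin d) ℝ).mulVec (xvec d) i *
        (A : Matrix (Fin d) (Fin d) ℝ).mulVec (yvec d θ) i = cos θ := by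
      change (A : Matrix (Fin d) (Fin d) ℝ).mulVec (xvec d) ⬝ᵥ
        (A : Matrix (Fin d) (Fin d) ℝ).mulVec (yvec d θ) = cos θ
      rw [Matrix.dotProduct_mulVec, ← Matrix.mulVec_transpose, Matrix.mulVec_mulVec, h1,
        Matrix.one_mulVec, hx, hy, sum_vv d hd]
      simp [vv]
    have hge : 0 ≤ cos θ := hsum ▸ Finset.sum_nonneg fun i _ => hnn i
    have h0 : cos θ = 0 := le_antisymm hcos hge
    have hs : sin θ ≠ 0 := by
      intro h
      have := Real.sin_sq_add_cos_sq θ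
      rw [h, h0] at this
      norm_num at this
    rw [h0] at hsum
    have hz := (Finset.sum_eq_zero_iff_of_nonneg fun i _ => hnn i).mp hsum
    intro i
    have := hz i (Finset.mem_univ i)
    rw [hx, hy] at this
    simp only [Matrix.mulVec, sum_vv d hd, h0] at this
    have h' : ((A : Matrix (Fin d) (Fin d) ℝ) i ⟨0, by omega⟩ *
      (A : Matrix (Fin d) (Fin d) ℝ) i ⟨1, by omega⟩) * sin θ = 0 := by
      linear_combination this
    exact (mul_eq_zero.mp h').resolve_right hs
  rw [collProb, measure_mono_null hsub (aux_null d hd μ hHaar hProb), ENNReal.toReal_zero]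
end
end
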